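/- arXiv:1308.6696 — 3 statements merged into one kernel-verified Lean document; each statement's English description precedes it below -/
import Mathlib

section
/- For all integers n ≥ 2 and r ≥ 2: every n-uniform hypergraph whose chromatic number is greater than r has at least (√3 − 1) · (n/ln n)^{1/2} · r^{n−1} edges; that is, m(n,r) ≥ (√3 − 1) · (n/ln n)^{1/2} · r^{n−1}. -/
open Finset in
lemma cyl_count {V D : Type} [Fintype V] [DecidableEq V] [Fintype D] [DecidableEq D] [Nonempty D]
    (T : Finset V) (S : V → Finset D) (hS : ∀ u, u ∉ T → S u = Finset.univ) :
    ((Fintype.piFinset S).card : ℝ) =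
      (Fintype.card D : ℝ) ^ (Fintype.card V) *
        ∏ u ∈ T, ((S u).card / (Fintype.card D : ℝ)) := by
  have hD : (Fintype.card D : ℝ) ≠ 0 := by
    exact_mod_cast Fintype.card_ne_zero
  have h1 : ∏ u ∈ T, ((S u).card / (Fintype.card D : ℝ))
      = ∏ u, ((S u).card / (Fintype.card D : ℝ)) := by
    apply Finset.prod_subset (Finset.subset_univ _)
    intro u _ hu
    rw [hS u hu, Finset.card_univ, div_self hD]
  rw [h1, Fintype.card_piFinset, Finset.prod_div_distrib, Finset.prod_const, Finset.card_univ]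
  push_cast
  field_simp

/-- Cylinder for an edge which stays monochromatic of color `i`. -/
def badOne {V : Type} [DecidableEq V] (r N P : ℕ) (A : Finset V) (i : Fin r) (u : V) :
    Finset (Fin r × Fin N) :=
  if u ∈ A then ({i} : Finset (Fin r)) ×ˢ (Finset.univ.filter fun y : Fin N => P ≤ y.val)
  else Finset.univ

/-- Cylinder for the edge `B` becoming monochromatic because of `A`. -/
def badTwo {V : Type} [DecidableEq V] (r N : ℕ) (A B : Finset V) (i j : Fin r) (x : Fin N)
    (u : V) : Finset (Fin r × Fin N) :=
  if u ∈ A then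
    (if u ∈ B then {(i, x)}
      else ({i} : Finset (Fin r)) ×ˢ (Finset.univ.filter fun y : Fin N => x ≤ y))
  else if u ∈ B then
    (({j} : Finset (Fin r)) ×ˢ (Finset.univ : Finset (Fin N))) ∪
      (({i} : Finset (Fin r)) ×ˢ (Finset.univ.filter fun y : Fin N => y ≤ x))
  else Finset.univ

lemma badOne_card {V : Type} [Fintype V] [DecidableEq V] (n r N P : ℕ) (hr : 0 < r) (hN : 0 < N)
    (hP : P ≤ N) (A : Finset V) (hA : A.card = n) (i : Fin r) :
    ((Fintype.piFinset (badOne r N P A i)).card : ℝ) =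
      ((r : ℝ) * N) ^ (Fintype.card V) * ((1 - P / N) / r) ^ n := by
  have : Nonempty (Fin r × Fin N) := ⟨(⟨0, hr⟩, ⟨0, hN⟩)⟩
  rw [cyl_count A _ (fun u hu => by simp [badOne, hu])]
  have hc : (Finset.univ.filter fun y : Fin N => P ≤ y.val).card = N - P := by
    have := Fin.card_filter_val_lt (n := N) (m := P)
    have h2 := Finset.card_filter_add_card_filter_not (s := (Finset.univ : Finset (Fin N)))
      (fun y : Fin N => y.val < P)
    simp only [not_lt, Finset.card_univ, Fintype.card_fin] at h2
    rw [this] at h2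
    omega
  have hN' : (N : ℝ) ≠ 0 := by positivity
  have hr' : (r : ℝ) ≠ 0 := by positivity
  rw [Finset.prod_congr rfl (g := fun _ => (1 - (P : ℝ) / N) / r)]
  · rw [Finset.prod_const, hA]; simp
  · intro u hu
    simp only [badOne, hu, if_true, Finset.card_product, Finset.card_singleton, hc,
      Fintype.card_prod, Fintype.card_fin, one_mul]
    push_cast [Nat.cast_sub hP]
    field_simp

lemma badTwo_card {V : Type} [Fintype V] [DecidableEq V] (n r N : ℕ) (hn : 1 ≤ n)
    (hr : 0 < r) (hN : 0 < N)
    (A B : Finset V) (hA : A.card = n) (hB : B.card = n) (hAB : (A ∩ B).card = 1)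
    (i j : Fin r) (x : Fin N) :
    ((Fintype.piFinset (badTwo r N A B i j x)).card : ℝ) ≤
      ((r : ℝ) * N) ^ (Fintype.card V) *
        (1 / (r * N) * ((1 + 1 / N) / (r : ℝ) ^ 2) ^ (n - 1)) := by
  have : Nonempty (Fin r × Fin N) := ⟨(⟨0, hr⟩, ⟨0, hN⟩)⟩
  have hN' : (0 : ℝ) < N := by positivity
  have hr' : (0 : ℝ) < r := by positivity
  rw [cyl_count (A ∪ B) _ (fun u hu => by
    simp only [Finset.mem_union, not_or] at hu
    simp [badTwo, hu])]
  have hcD : (Fintype.card (Fin r × Fin N) : ℝ) = r * N := by simp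
  rw [hcD]
  apply mul_le_mul_of_nonneg_left _ (by positivity)
  have hAB1 : (A \ B).card = n - 1 := by
    have := Finset.card_sdiff_add_card_inter A B
    omega
  have hBA1 : (B \ A).card = n - 1 := by
    have := Finset.card_sdiff_add_card_inter B A
    rw [Finset.inter_comm] at this
    omega
  have hsplit : A ∪ B = (A ∩ B) ∪ ((A \ B) ∪ (B \ A)) := by
    ext u; simp; tauto
  have hd1 : Disjoint (A ∩ B) ((A \ B) ∪ (B \ A)) := by
    rw [Finset.disjoint_left]; intro u; simp; tauto
  have hd2 : Disjoint (A \ B) (B \ A) := by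
    rw [Finset.disjoint_left]; intro u; simp; tauto
  rw [hsplit, Finset.prod_union hd1, Finset.prod_union hd2]
  have e1 : ∏ u ∈ A ∩ B, (((badTwo r N A B i j x u).card : ℝ) / (r * N)) = 1 / (r * N) := by
    rw [Finset.prod_congr rfl (g := fun _ => 1 / ((r : ℝ) * N))]
    · rw [Finset.prod_const, hAB, pow_one]
    · intro u hu
      simp only [Finset.mem_inter] at hu
      simp [badTwo, hu]
  have e2 : ∏ u ∈ A \ B, (((badTwo r N A B i j x u).card : ℝ) / (r * N))
      = ((N - x : ℝ) / (r * N)) ^ (n - 1) := by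
    rw [Finset.prod_congr rfl (g := fun _ => (N - x : ℝ) / ((r : ℝ) * N))]
    · rw [Finset.prod_const, hAB1]
    · intro u hu
      simp only [Finset.mem_sdiff] at hu
      have : (Finset.univ.filter fun y : Fin N => x ≤ y) = Finset.Ici x := by ext; simp
      simp [badTwo, hu, this, Nat.cast_sub x.2.le]
  have e3 : ∏ u ∈ B \ A, (((badTwo r N A B i j x u).card : ℝ) / (r * N))
      ≤ ((N + x + 1 : ℝ) / (r * N)) ^ (n - 1) := by
    rw [← hBA1, ← Finset.prod_const]
    apply Finset.prod_le_prod
    · intros; positivity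
    · intro u hu
      simp only [Finset.mem_sdiff] at hu
      have : (Finset.univ.filter fun y : Fin N => y ≤ x) = Finset.Iic x := by ext; simp
      have h2 : (badTwo r N A B i j x u).card ≤ N + (x + 1) := by
        simp only [badTwo, hu, if_true, if_false]
        refine (Finset.card_union_le _ _).trans ?_
        simp [this]
      have h3 : ((badTwo r N A B i j x u).card : ℝ) ≤ N + x + 1 := by
        have : ((badTwo r N A B i j x u).card : ℝ) ≤ ((N + (x + 1) : ℕ) : ℝ) := by
          exact_mod_cast h2
        push_cast at this
        linarith
      gcongr
  rw [e1, e2]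
  have hx : (x : ℝ) ≤ N := by exact_mod_cast x.2.le
  apply mul_le_mul_of_nonneg_left _ (by positivity)
  have hnn : (0 : ℝ) ≤ (N - x : ℝ) / (r * N) := div_nonneg (by linarith) (by positivity)
  refine (mul_le_mul_of_nonneg_left e3 (pow_nonneg hnn _)).trans ?_
  rw [← mul_pow]
  apply pow_le_pow_left₀ (by positivity)
  have hx0 : (0 : ℝ) ≤ x := by positivity
  rw [div_mul_div_comm, div_le_div_iff₀ (by positivity) (by positivity)]
  have : (1 + 1 / (N : ℝ)) * (r * N * (r * N)) = (N ^ 2 + N) * r ^ 2 := by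
    field_simp
  rw [this]
  apply mul_le_mul_of_nonneg_right _ (by positivity)
  nlinarith

/-- The recolouring lemma: any configuration lies in one of the bad cylinders. -/
lemma exists_bad {V : Type} [Fintype V] [DecidableEq V] (r N P : ℕ) 
    (E : Finset (Finset V)) (hne : ∀ A ∈ E, A.Nonempty)
    (s : Fin r → Fin r) (hs : Function.Injective s) (hs' : ∀ i, s i ≠ i)
    (hchrom : ∀ c : V → Fin r, ∃ A ∈ E, ∃ i : Fin r, ∀ v ∈ A, c v = i)
    (ω : V → Fin r × Fin N) :
    (∃ A ∈ E, ∃ i, ω ∈ Fintype.piFinset (badOne r N P A i)) ∨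
    (∃ A ∈ E, ∃ B ∈ E, (A ∩ B).card = 1 ∧ ∃ i, ∃ x : Fin N, x.val < P ∧
      ω ∈ Fintype.piFinset (badTwo r N A B i (s i) x)) := by
  classical
  let e := Fintype.equivFin V
  let key : V → Fin N ×ₗ Fin (Fintype.card V) := fun v => toLex ((ω v).2, e v)
  have hkey : Function.Injective key := by
    intro a b hab
    have : (ofLex (key a)).2 = (ofLex (key b)).2 := by rw [hab]
    exact e.injective this
  have hkey2 : ∀ a b, key a ≤ key b → (ω a).2 ≤ (ω b).2 := by
    intro a b hab
    have := (Prod.Lex.le_iff).1 hab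
    rcases this with h | h
    · exact le_of_lt h
    · exact le_of_eq h.1
  let rec' : V → Prop := fun v => (ω v).2.val < P ∧ ∃ A ∈ E, v ∈ A ∧
    ∀ u ∈ A, (ω u).1 = (ω v).1 ∧ key v ≤ key u
  let c : V → Fin r := fun v => if rec' v then s (ω v).1 else (ω v).1
  obtain ⟨B, hB, j, hj⟩ := hchrom c
  by_cases hex : ∃ v ∈ B, rec' v
  · right
    obtain ⟨v, hv, hmax⟩ := Finset.exists_max_image (B.filter rec') key (by
      obtain ⟨v, hv, h⟩ := hex
      exact ⟨v, by simp [hv, h]⟩)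
    simp only [Finset.mem_filter] at hv hmax
    obtain ⟨hvB, hvr⟩ := hv
    obtain ⟨hvP, A, hA, hvA, hAu⟩ := id hvr
    have hjv : s (ω v).1 = j := by
      have := hj v hvB
      simpa [c, hvr] using this
    have hrec : ∀ u ∈ B, rec' u → (ω u).1 = (ω v).1 := by
      intro u hu hur
      have := hj u hu
      simp only [c, hur, if_true] at this
      exact hs (this.trans hjv.symm)
    have hnrec : ∀ u ∈ B, ¬ rec' u → (ω u).1 = s (ω v).1 := by
      intro u hu hur
      have := hj u hu
      simp only [c, hur, if_false] at this
      exact this.trans hjv.symm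
    have hint : A ∩ B = {v} := by
      ext u
      simp only [Finset.mem_inter, Finset.mem_singleton]
      constructor
      · rintro ⟨huA, huB⟩
        by_cases hur : rec' u
        · exact hkey (le_antisymm (hmax u ⟨huB, hur⟩) (hAu u huA).2)
        · exact absurd ((hnrec u huB hur).symm.trans (hAu u huA).1) (hs' _)
      · rintro rfl
        exact ⟨hvA, hvB⟩
    refine ⟨A, hA, B, hB, by rw [hint]; simp, (ω v).1, (ω v).2, hvP, ?_⟩
    rw [Fintype.mem_piFinset]
    intro u
    unfold badTwo
    split_ifs with h1 h2 h3
    · have : u ∈ A ∩ B := Finset.mem_inter.2 ⟨h1, h2⟩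
      rw [hint, Finset.mem_singleton] at this
      subst this
      simp
    · simp only [Finset.mem_product, Finset.mem_singleton, Finset.mem_filter, Finset.mem_univ,
        true_and]
      exact ⟨(hAu u h1).1, hkey2 _ _ (hAu u h1).2⟩
    · simp only [Finset.mem_union, Finset.mem_product, Finset.mem_singleton, Finset.mem_filter,
        Finset.mem_univ, true_and, and_true]
      by_cases hur : rec' u
      · right
        exact ⟨hrec u h3 hur, hkey2 _ _ (hmax u ⟨h3, hur⟩)⟩
      · left
        exact hnrec u h3 hur
    · simp
  · left
    push Not at hex
    have hcol : ∀ u ∈ B, (ω u).1 = j := by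
      intro u hu
      have := hj u hu
      simpa only [c, hex u hu, if_false] using this
    refine ⟨B, hB, j, ?_⟩
    obtain ⟨v, hv, hmin⟩ := Finset.exists_min_image B key (hne B hB)
    have hvP : P ≤ (ω v).2.val := by
      by_contra hlt
      push Not at hlt
      exact hex v hv ⟨hlt, B, hB, hv, fun u hu => ⟨(hcol u hu).trans (hcol v hv).symm, hmin u hu⟩⟩
    rw [Fintype.mem_piFinset]
    intro u
    unfold badOne
    split_ifs with h1
    · simp only [Finset.mem_product, Finset.mem_singleton, Finset.mem_filter, Finset.mem_univ,
        true_and]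
      exact ⟨hcol u h1, hvP.trans (hkey2 _ _ (hmin u h1))⟩
    · simp

lemma key_ineq {V : Type} [Fintype V] [DecidableEq V] (n r N P : ℕ) (hn : 1 ≤ n) (hr : 2 ≤ r)
    (hN : 0 < N) (hP : P ≤ N) (E : Finset (Finset V)) (hunif : ∀ A ∈ E, A.card = n)
    (hchrom : ∀ c : V → Fin r, ∃ A ∈ E, ∃ i : Fin r, ∀ v ∈ A, c v = i) :
    (1 : ℝ) ≤ (E.card / (r : ℝ) ^ (n - 1)) * (1 - P / N) ^ n +
      (E.card / (r : ℝ) ^ (n - 1)) ^ 2 * (P / N) * (1 + 1 / N) ^ (n - 1) := by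
  classical
  obtain ⟨q, rfl⟩ : ∃ q, r = q + 2 := ⟨r - 2, by omega⟩
  set r := q + 2 with hrdef
  have hN' : (0 : ℝ) < N := by positivity
  have hr0 : 0 < r := by omega
  have hr' : (0 : ℝ) < r := by exact_mod_cast hr0
  let s : Fin r → Fin r := fun i => i + 1
  have hs : Function.Injective s := fun a b h => by simpa [s] using h
  have hs' : ∀ i, s i ≠ i := fun i h => by
    simp [s] at h
  let F1 : Finset (V → Fin r × Fin N) :=
    E.biUnion fun A => Finset.univ.biUnion fun i => Fintype.piFinset (badOne r N P A i)
  let X : Finset (Fin N) := Finset.univ.filter fun x => x.val < P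
  let Q : Finset (Finset V × Finset V) := (E ×ˢ E).filter fun p => (p.1 ∩ p.2).card = 1
  let F2 : Finset (V → Fin r × Fin N) :=
    Q.biUnion fun p => Finset.univ.biUnion fun i => X.biUnion fun x =>
      Fintype.piFinset (badTwo r N p.1 p.2 i (s i) x)
  have hcover : (Finset.univ : Finset (V → Fin r × Fin N)) ⊆ F1 ∪ F2 := by
    intro ω _
    rw [Finset.mem_union]
    rcases exists_bad r N P E (fun A hA => Finset.card_pos.1 (by rw [hunif A hA]; omega))
      s hs hs' hchrom ω with ⟨A, hA, i, h⟩ | ⟨A, hA, B, hB, hAB, i, x, hx, h⟩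
    · left
      simp only [F1, Finset.mem_biUnion]
      exact ⟨A, hA, i, Finset.mem_univ _, h⟩
    · right
      simp only [F2, Finset.mem_biUnion]
      exact ⟨(A, B), by simp [Q, hA, hB, hAB], i, Finset.mem_univ _, x, by simp [X, hx], h⟩
  have hcard := (Finset.card_le_card hcover).trans (Finset.card_union_le _ _)
  set W : ℝ := ((r : ℝ) * N) ^ (Fintype.card V) with hW
  have hWpos : 0 < W := by positivity
  have hu : ((Finset.univ : Finset (V → Fin r × Fin N)).card : ℝ) = W := by
    simp [hW]
  have h1 : (F1.card : ℝ) ≤ E.card * (r * (W * ((1 - P / N) / r) ^ n)) := by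
    have a : F1.card ≤ ∑ A ∈ E, ∑ i : Fin r, (Fintype.piFinset (badOne r N P A i)).card :=
      Finset.card_biUnion_le.trans (Finset.sum_le_sum fun A _ => Finset.card_biUnion_le)
    have b : (F1.card : ℝ) ≤ ∑ A ∈ E, ∑ i : Fin r,
        ((Fintype.piFinset (badOne r N P A i)).card : ℝ) := by exact_mod_cast a
    refine b.trans (le_of_eq ?_)
    rw [Finset.sum_congr rfl (g := fun _ => r * (W * ((1 - (P : ℝ) / N) / r) ^ n))]
    · rw [Finset.sum_const, nsmul_eq_mul]
    · intro A hA
      rw [Finset.sum_congr rfl (fun i _ => badOne_card n r N P hr0 hN hP A (hunif A hA) i)]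
      rw [Finset.sum_const, nsmul_eq_mul, Finset.card_univ, Fintype.card_fin]
  have h2 : (F2.card : ℝ) ≤ ((E.card : ℝ) * E.card) * (r * (P *
      (W * (1 / (r * N) * ((1 + 1 / N) / (r : ℝ) ^ 2) ^ (n - 1))))) := by
    have a : F2.card ≤ ∑ p ∈ Q, ∑ i : Fin r, ∑ x ∈ X,
        (Fintype.piFinset (badTwo r N p.1 p.2 i (s i) x)).card :=
      Finset.card_biUnion_le.trans (Finset.sum_le_sum fun A _ =>
        Finset.card_biUnion_le.trans (Finset.sum_le_sum fun A _ => Finset.card_biUnion_le))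
    have b : (F2.card : ℝ) ≤ ∑ p ∈ Q, ∑ i : Fin r, ∑ x ∈ X,
        ((Fintype.piFinset (badTwo r N p.1 p.2 i (s i) x)).card : ℝ) := by exact_mod_cast a
    refine b.trans ?_
    set t : ℝ := W * (1 / (r * N) * ((1 + 1 / N) / (r : ℝ) ^ 2) ^ (n - 1)) with ht
    have htpos : 0 ≤ t := by positivity
    have hX : X.card ≤ P := by
      have := Fin.card_filter_val_lt (n := N) (m := P)
      simp only [X, this]
      omega
    have hX' : (X.card : ℝ) ≤ P := by exact_mod_cast hX
    have hQ : Q.card ≤ E.card * E.card := by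
      rw [← Finset.card_product]; exact Finset.card_filter_le _ _
    have hQ' : (Q.card : ℝ) ≤ E.card * E.card := by exact_mod_cast hQ
    calc _ ≤ ∑ p ∈ Q, (r * (P * t) : ℝ) := by
          apply Finset.sum_le_sum
          intro p hp
          simp only [Q, Finset.mem_filter, Finset.mem_product] at hp
          calc _ ≤ ∑ i : Fin r, (P * t : ℝ) := by
                apply Finset.sum_le_sum
                intro i _
                calc _ ≤ ∑ x ∈ X, t := by
                      apply Finset.sum_le_sum
                      intro x _
                      exact badTwo_card n r N hn hr0 hN p.1 p.2 (hunif _ hp.1.1)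
                        (hunif _ hp.1.2) hp.2 i (s i) x
                  _ ≤ P * t := by
                      rw [Finset.sum_const, nsmul_eq_mul]
                      gcongr
            _ = r * (P * t) := by
                rw [Finset.sum_const, nsmul_eq_mul, Finset.card_univ, Fintype.card_fin]
      _ ≤ _ := by
          rw [Finset.sum_const, nsmul_eq_mul]
          gcongr
  have hcard' : W ≤ F1.card + F2.card := by
    rw [← hu]; exact_mod_cast hcard
  obtain ⟨k, rfl⟩ : ∃ k, n = k + 1 := ⟨n - 1, by omega⟩
  simp only [Nat.add_sub_cancel] at *
  have hfin : W ≤ W * ((E.card / (r : ℝ) ^ k) * (1 - P / N) ^ (k + 1) +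
      (E.card / (r : ℝ) ^ k) ^ 2 * (P / N) * (1 + 1 / N) ^ k) := by
    refine (hcard'.trans (add_le_add h1 h2)).trans (le_of_eq ?_)
    rw [mul_add, div_pow, div_pow (1 + 1 / (N : ℝ))]
    congr 1
    · field_simp
      ring
    · rw [← pow_mul, mul_comm 2 k, pow_mul]
      field_simp
  exact le_of_mul_le_mul_left (by simpa using hfin) hWpos

lemma graph_case {V : Type} [Fintype V] [DecidableEq V] (r : ℕ) 
    (E : Finset (Finset V)) (hunif : ∀ A ∈ E, A.card = 2)
    (hchrom : ∀ c : V → Fin r, ∃ A ∈ E, ∃ i : Fin r, ∀ v ∈ A, c v = i) :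
    (r + 1).choose 2 ≤ E.card := by
  classical
  let Good : ℕ → Prop := fun t => ∃ c : V → Fin t, ∀ A ∈ E, ∀ i, ∃ v ∈ A, c v ≠ i
  have hex : ∃ t, Good t := by
    refine ⟨Fintype.card V, Fintype.equivFin V, ?_⟩
    intro A hA i
    obtain ⟨a, b, hab, rfl⟩ := Finset.card_eq_two.1 (hunif A hA)
    by_contra h
    push Not at h
    exact hab ((Fintype.equivFin V).injective ((h a (by simp)).trans (h b (by simp)).symm))
  set t := Nat.find hex with ht
  obtain ⟨c, hc⟩ : Good t := Nat.find_spec hex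
  have hrt : r + 1 ≤ t := by
    by_contra hlt
    have hle : t ≤ r := by omega
    obtain ⟨A, hA, i, hi⟩ := hchrom (fun v => Fin.castLE hle (c v))
    obtain ⟨a, b, hab, rfl⟩ := Finset.card_eq_two.1 (hunif A hA)
    obtain ⟨v, hv, hvne⟩ := hc _ hA (c a)
    apply hvne
    exact Fin.castLE_injective hle ((hi v hv).trans (hi a (by simp)).symm)
  have hsub : Finset.powersetCard 2 (Finset.univ : Finset (Fin t)) ⊆ E.image (Finset.image c) := by
    intro S hS
    rw [Finset.mem_powersetCard] at hS
    obtain ⟨i, j, hij, rfl⟩ := Finset.card_eq_two.1 hS.2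
    by_contra hno
    obtain ⟨k, hk⟩ : ∃ k, t = k + 1 := ⟨t - 1, by omega⟩
    have hmin : ¬ Good k := Nat.find_min hex (by omega)
    apply hmin
    let f : Fin t → {x : Fin t // x ≠ j} := fun x => if h : x = j then ⟨i, hij⟩ else ⟨x, h⟩
    have hcardf : Fintype.card {x : Fin t // x ≠ j} = k := by
      rw [Fintype.card_subtype_compl]
      simp [hk]
    let g := Fintype.equivFinOfCardEq hcardf
    refine ⟨fun v => g (f (c v)), ?_⟩
    intro A hA y
    by_contra hall
    push Not at hall
    obtain ⟨a, b, hab, rfl⟩ := Finset.card_eq_two.1 (hunif A hA)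
    have heq : f (c a) = f (c b) := g.injective ((hall a (by simp)).trans (hall b (by simp)).symm)
    have hne : c a ≠ c b := by
      intro h
      obtain ⟨v, hv, hvne⟩ := hc _ hA (c a)
      simp only [Finset.mem_insert, Finset.mem_singleton] at hv
      rcases hv with rfl | rfl
      · exact hvne rfl
      · exact hvne h.symm
    apply hno
    rw [Finset.mem_image]
    refine ⟨_, hA, ?_⟩
    rw [Finset.image_insert, Finset.image_singleton]
    simp only [f] at heq
    split_ifs at heq with h1 h2 h2
    · exact absurd (h1.trans h2.symm) hne
    · simp only [Subtype.mk.injEq] at heq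
      rw [h1, ← heq, Finset.pair_comm]
    · simp only [Subtype.mk.injEq] at heq
      rw [h2, heq]
    · simp only [Subtype.mk.injEq] at heq
      exact absurd heq hne
  have h1 := (Finset.card_le_card hsub).trans Finset.card_image_le
  rw [Finset.card_powersetCard, Finset.card_univ, Fintype.card_fin] at h1
  exact (Nat.choose_le_choose 2 hrt).trans h1

/-- Letting the discretisation go to infinity. -/
lemma limit_ineq {V : Type} [Fintype V] [DecidableEq V] (n r : ℕ) (hn : 1 ≤ n) (hr : 2 ≤ r)
    (E : Finset (Finset V)) (hunif : ∀ A ∈ E, A.card = n)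
    (hchrom : ∀ c : V → Fin r, ∃ A ∈ E, ∃ i : Fin r, ∀ v ∈ A, c v = i)
    (p : ℝ) (hp0 : 0 ≤ p) (hp1 : p ≤ 1) :
    (1 : ℝ) ≤ (E.card / (r : ℝ) ^ (n - 1)) * (1 - p) ^ n +
      (E.card / (r : ℝ) ^ (n - 1)) ^ 2 * p := by
  set k : ℝ := E.card / (r : ℝ) ^ (n - 1) with hk
  have hk0 : 0 ≤ k := by positivity
  have hlim : Filter.Tendsto (fun N : ℕ => k * (1 - p) ^ n +
      k ^ 2 * (p + 1 / (N : ℝ)) * (1 + 1 / (N : ℝ)) ^ (n - 1)) Filter.atTop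
      (nhds (k * (1 - p) ^ n + k ^ 2 * (p + 0) * (1 + 0) ^ (n - 1))) := by
    have h := tendsto_one_div_atTop_nhds_zero_nat (𝕜 := ℝ)
    exact tendsto_const_nhds.add (((tendsto_const_nhds.add h).const_mul _).mul
      ((tendsto_const_nhds.add h).pow _))
  have := ge_of_tendsto (b := (1 : ℝ)) hlim (by
    filter_upwards [Filter.eventually_gt_atTop 0] with N hN
    have hN' : (0 : ℝ) < N := by exact_mod_cast hN
    have hPN : ⌈p * N⌉₊ ≤ N := by
      rw [Nat.ceil_le]; nlinarith
    have h1 := key_ineq n r N ⌈p * N⌉₊ hn hr hN hPN E hunif hchrom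
    rw [← hk] at h1
    have h2 : p ≤ (⌈p * N⌉₊ : ℝ) / N := by
      rw [le_div_iff₀ hN']; exact Nat.le_ceil _
    have h3 : (⌈p * N⌉₊ : ℝ) / N ≤ p + 1 / N := by
      rw [div_le_iff₀ hN', add_mul, one_div, inv_mul_cancel₀ hN'.ne']
      exact (Nat.ceil_lt_add_one (by positivity)).le
    have h4 : (⌈p * N⌉₊ : ℝ) / N ≤ 1 := by
      rw [div_le_one hN']; exact_mod_cast hPN
    refine h1.trans ?_
    gcongr)
  simpa using this

/-- Shabanov's bound: for all `n ≥ 2` and `r ≥ 2`, every `n`-uniform hypergraph with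
chromatic number greater than `r` has at least `(√3 − 1) · (n / ln n)^{1/2} · r^{n−1}`
edges. -/
theorem stmt_9 (n r : ℕ) (hn : 2 ≤ n) (hr : 2 ≤ r)
    (V : Type) [Fintype V] [DecidableEq V] (E : Finset (Finset V))
    (hunif : ∀ A ∈ E, A.card = n)
    (hchrom : ∀ c : V → Fin r, ∃ A ∈ E, ∃ i : Fin r, ∀ v ∈ A, c v = i) :
    (E.card : ℝ) ≥
      (Real.sqrt 3 - 1) * ((n : ℝ) / Real.log n) ^ ((1 : ℝ) / 2) * (r : ℝ) ^ (n - 1) := by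
  rw [← Real.sqrt_eq_rpow]
  have hs3 : Real.sqrt 3 ^ 2 = 3 := Real.sq_sqrt (by norm_num)
  have hs3' : 1 < Real.sqrt 3 := by
    rw [Real.lt_sqrt (by norm_num)]; norm_num
  rcases hn.eq_or_lt with rfl | hn3
  · have h := graph_case r E hunif hchrom
    have h' : (((r + 1).choose 2 : ℕ) : ℝ) ≤ E.card := by exact_mod_cast h
    rw [Nat.cast_choose_two] at h'
    push_cast at h' ⊢
    have hr' : (2 : ℝ) ≤ r := by exact_mod_cast hr
    have hl := Real.log_two_gt_d9
    have hq : Real.sqrt (2 / Real.log 2) ≤ 2 := by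
      rw [Real.sqrt_le_left (by norm_num), div_le_iff₀ (by linarith)]
      linarith
    have h3 : Real.sqrt 3 ≤ 7 / 4 := by
      rw [Real.sqrt_le_left (by norm_num)]; norm_num
    have h4 : (Real.sqrt 3 - 1) * Real.sqrt (2 / Real.log 2) ≤ 3 / 2 := by
      nlinarith [Real.sqrt_nonneg (2 / Real.log 2)]
    simp only [Nat.add_one_sub_one, pow_one]
    nlinarith
  · have hn' : (3 : ℝ) ≤ n := by exact_mod_cast hn3
    set L := Real.log n with hL
    have hL1 : 1 ≤ L := by
      rw [hL, Real.le_log_iff_exp_le (by linarith)]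
      linarith [Real.exp_one_lt_d9]
    have hLn : L ≤ n := by
      have := Real.log_le_sub_one_of_pos (show (0 : ℝ) < n by linarith)
      linarith
    set p : ℝ := L / (2 * n) with hp
    have hp0 : 0 ≤ p := by positivity
    have hp1 : p ≤ 1 := by
      rw [hp, div_le_one (by linarith)]; linarith
    have hmain := limit_ineq n r (by omega) hr E hunif hchrom p hp0 hp1
    set k : ℝ := E.card / (r : ℝ) ^ (n - 1) with hk
    have hk0 : 0 ≤ k := by positivity
    have hrpos : (0 : ℝ) < (r : ℝ) ^ (n - 1) := by
      have : (0 : ℝ) < r := by exact_mod_cast (by omega : 0 < r)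
      positivity
    rw [ge_iff_le, ← le_div_iff₀ hrpos, ← hk]
    set w := Real.sqrt (n / L) with hw
    have hw0 : 0 < w := Real.sqrt_pos.2 (by positivity)
    have hw2 : w ^ 2 = n / L := Real.sq_sqrt (by positivity)
    have hpw : p * w ^ 2 = 1 / 2 := by
      rw [hw2, hp]; field_simp
    have hpow : (1 - p) ^ n * w ≤ 1 := by
      have e1 : (1 - p) ^ n ≤ Real.exp (-p) ^ n :=
        pow_le_pow_left₀ (by linarith) (Real.one_sub_le_exp_neg p) n
      have e2 : (Real.exp (-p) ^ n) ^ 2 = (n : ℝ)⁻¹ := by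
        rw [← pow_mul, ← Real.exp_nat_mul]
        have : ((n * 2 : ℕ) : ℝ) * (-p) = -L := by
          rw [hp]; push_cast; field_simp
        rw [this, Real.exp_neg, hL, Real.exp_log (by linarith)]
      have e3 : (Real.exp (-p) ^ n * w) ^ 2 ≤ 1 := by
        rw [mul_pow, e2, hw2]
        rw [show (n : ℝ)⁻¹ * (n / L) = 1 / L by field_simp]
        rw [div_le_one (by linarith)]; exact hL1
      have e4 : Real.exp (-p) ^ n * w ≤ 1 := by
        have : 0 ≤ Real.exp (-p) ^ n * w := by positivity
        nlinarith
      exact (mul_le_mul_of_nonneg_right e1 hw0.le).trans e4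
    by_contra hlt
    push Not at hlt
    obtain ⟨d, hd⟩ : ∃ d, k = d * w := ⟨k / w, by field_simp⟩
    have hd0 : 0 ≤ d := by
      by_contra h
      push Not at h
      nlinarith
    have hd1 : d < Real.sqrt 3 - 1 := by
      rw [hd] at hlt
      exact lt_of_mul_lt_mul_right hlt hw0.le
    have f1 : k * (1 - p) ^ n ≤ d := by
      rw [hd]
      nlinarith
    have f2 : k ^ 2 * p = d ^ 2 / 2 := by
      rw [hd, mul_pow, mul_assoc, mul_comm (w ^ 2), hpw]; ring
    nlinarith
end

section
/- For all integers n ≥ 2 and r ≥ 3: every n-uniform hypergraph whose chromatic number is greater than r has at least (1/4) · n^{1/2} · r^{n−1} edges; that is, m(n,r) ≥ (1/4) · n^{1/2} · r^{n−1}. -/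
open Finset

lemma H_count {V α : Type} [Fintype V] [DecidableEq V] [DecidableEq α] (G : V → Finset α)
    (U : Finset V) (M : ℕ) (hM : ∀ w, w ∉ U → (G w).card ≤ M) :
    M ^ U.card * (Fintype.piFinset G).card ≤ M ^ (Fintype.card V) * ∏ w ∈ U, (G w).card := by
  rw [Fintype.card_piFinset, ← Finset.prod_mul_prod_compl U]
  have h1 : ∏ w ∈ Uᶜ, (G w).card ≤ M ^ (Uᶜ).card :=
    Finset.prod_le_pow_card _ _ _ (fun w hw => hM w (by simpa using hw))
  have h2 : M ^ (Fintype.card V) = M ^ U.card * M ^ (Uᶜ).card := by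
    rw [← pow_add, Finset.card_add_card_compl]
  rw [h2]
  calc _ ≤ M ^ U.card * ((∏ w ∈ U, (G w).card) * M ^ (Uᶜ).card) := by gcongr
    _ = _ := by ring

lemma trivial_bound (n r : ℕ) (hn : 2 ≤ n) (hr : 3 ≤ r)
    (V : Type) [Fintype V] [DecidableEq V] (E : Finset (Finset V))
    (hunif : ∀ A ∈ E, A.card = n)
    (hchrom : ∀ c : V → Fin r, ∃ A ∈ E, ∃ i : Fin r, ∀ v ∈ A, c v = i) :
    r ^ (n - 1) ≤ E.card := by
  classical
  let G : Finset V → Fin r → V → Finset (Fin r) := fun A i w => if w ∈ A then {i} else univ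
  have hcov : (univ : Finset (V → Fin r)) ⊆
      E.biUnion (fun A => univ.biUnion (fun i => Fintype.piFinset (G A i))) := by
    intro c _
    obtain ⟨A, hA, i, hi⟩ := hchrom c
    simp only [mem_biUnion, Fintype.mem_piFinset, mem_univ, true_and]
    refine ⟨A, hA, i, fun w => ?_⟩
    by_cases hw : w ∈ A
    · simp [G, hw, hi w hw]
    · simp [G, hw]
  have h1 : r ^ Fintype.card V ≤ ∑ A ∈ E, ∑ i : Fin r, (Fintype.piFinset (G A i)).card := by
    calc r ^ Fintype.card V = (univ : Finset (V → Fin r)).card := by simp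
      _ ≤ _ := card_le_card hcov
      _ ≤ _ := card_biUnion_le.trans (sum_le_sum fun A _ => card_biUnion_le)
  have h2 : ∀ A ∈ E, ∀ i, r ^ n * (Fintype.piFinset (G A i)).card ≤ r ^ Fintype.card V := by
    intro A hA i
    have := H_count (G A i) A r (fun w hw => by simp [G, hw])
    rw [hunif A hA] at this
    refine this.trans ?_
    rw [Finset.prod_eq_one (fun w hw => by simp [G, hw]), mul_one]
  have h3 : r ^ n * r ^ Fintype.card V ≤ (E.card * r) * r ^ Fintype.card V := by
    calc r ^ n * r ^ Fintype.card V
        ≤ r ^ n * ∑ A ∈ E, ∑ i : Fin r, (Fintype.piFinset (G A i)).card := by gcongr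
      _ = ∑ A ∈ E, ∑ i : Fin r, r ^ n * (Fintype.piFinset (G A i)).card := by
          simp only [mul_sum]
      _ ≤ ∑ A ∈ E, ∑ i : Fin r, r ^ Fintype.card V :=
          sum_le_sum fun A hA => sum_le_sum fun i _ => h2 A hA i
      _ = _ := by simp; ring
  have h4 := Nat.le_of_mul_le_mul_right h3 (by positivity)
  obtain ⟨k, rfl⟩ : ∃ k, n = k + 1 := ⟨n - 1, by omega⟩
  rw [pow_succ] at h4
  exact Nat.le_of_mul_le_mul_right h4 (by omega)

/-- chain of length `s` -/
def IsChn {V K : Type} [LinearOrder K] (E : Finset (Finset V)) (key : V → K)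
    (A : ℕ → Finset V) (u : ℕ → V) (s : ℕ) : Prop :=
  ∀ i < s, A i ∈ E ∧ u i ∈ A i ∧ u (i + 1) ∈ A i ∧
    ∀ w ∈ A i, key (u i) ≤ key w ∧ key w ≤ key (u (i + 1))

lemma exists_chain (r : ℕ)
    {V K : Type} [LinearOrder K] [DecidableEq V] (E : Finset (Finset V)) (key : V → K)
    (hne : ∀ A ∈ E, A.Nonempty)
    (hchrom : ∀ c : V → Fin r, ∃ A ∈ E, ∃ i : Fin r, ∀ v ∈ A, c v = i) :
    ∃ A u, IsChn E key A u r := by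
  classical
  by_contra hno
  push Not at hno
  let P : V → ℕ → Prop := fun v s => ∃ A u, u s = v ∧ IsChn E key A u s
  have hP0 : ∀ v, P v 0 := fun v => ⟨fun _ => ∅, fun _ => v, rfl, fun i hi => by omega⟩
  let c : V → ℕ := fun v => Nat.findGreatest (P v) r
  have hcP : ∀ v, P v (c v) := fun v => Nat.findGreatest_spec (Nat.zero_le r) (hP0 v)
  have hc : ∀ v, c v < r := by
    intro v
    refine lt_of_le_of_ne (Nat.findGreatest_le r) (fun h => ?_)
    obtain ⟨A, u, _, hch⟩ := hcP v
    rw [h] at hch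
    exact hno A u hch
  obtain ⟨B, hB, i, hi⟩ := hchrom (fun v => ⟨c v, hc v⟩)
  obtain ⟨a, haB, ha⟩ := Finset.exists_min_image B key (hne B hB)
  obtain ⟨b, hbB, hb⟩ := Finset.exists_max_image B key (hne B hB)
  have hab : c a = c b := by
    have h1 := hi a haB
    have h2 := hi b hbB
    rw [← h2] at h1
    simpa using h1
  have hPb : P b (c a + 1) := by
    obtain ⟨A, u, hu, hch⟩ := hcP a
    refine ⟨fun j => if j < c a then A j else B, fun j => if j ≤ c a then u j else b, by simp, ?_⟩
    intro j hj
    rcases Nat.lt_succ_iff_lt_or_eq.mp hj with h | h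
    · have h' : j + 1 ≤ c a := h
      simp only [h, h.le, h', if_true]
      exact hch j h
    · subst h
      simp only [lt_irrefl, le_refl, if_true, if_false, hu, Nat.not_succ_le_self]
      exact ⟨hB, haB, hbB, fun w hw => ⟨ha w hw, hb w hw⟩⟩
  have : c a + 1 ≤ c b := Nat.le_findGreatest (hc a) hPb
  omega

lemma count_short {V : Type} [Fintype V] [DecidableEq V] (A : Finset V) (n M L : ℕ)
    (hA : A.card = n) (F : Finset (V → ℕ))
    (hF : ∀ x ∈ F, (∀ w, x w < M) ∧ ∃ v ∈ A, ∀ w ∈ A, x v ≤ x w ∧ x w < x v + L) :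
    M ^ n * F.card ≤ n * M * (M ^ Fintype.card V * L ^ (n - 1)) := by
  classical
  let G : V → ℕ → V → Finset ℕ := fun v s w =>
    if w = v then {s} else if w ∈ A then Ico s (s + L) else range M
  have hcov : F ⊆ A.biUnion (fun v => (range M).biUnion (fun s => Fintype.piFinset (G v s))) := by
    intro x hx
    obtain ⟨hM, v, hv, h⟩ := hF x hx
    simp only [mem_biUnion, Fintype.mem_piFinset]
    refine ⟨v, hv, x v, by simpa using hM v, fun w => ?_⟩
    by_cases hwv : w = v
    · simp [G, hwv]
    · by_cases hw : w ∈ A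
      · simp [G, hwv, hw, h w hw]
      · simp [G, hwv, hw, hM w]
  have h2 : ∀ v ∈ A, ∀ s, M ^ n * (Fintype.piFinset (G v s)).card
      ≤ M ^ Fintype.card V * L ^ (n - 1) := by
    intro v hv s
    have := H_count (G v s) A M (fun w hw => by
      have : w ≠ v := fun h => hw (h ▸ hv)
      simp [G, hw, this])
    rw [hA] at this
    refine this.trans ?_
    gcongr
    rw [← Finset.mul_prod_erase A _ hv]
    have : ∏ w ∈ A.erase v, (G v s w).card ≤ L ^ (A.erase v).card :=
      Finset.prod_le_pow_card _ _ _ (fun w hw => by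
        have h1 := Finset.ne_of_mem_erase hw
        have h2 := Finset.mem_of_mem_erase hw
        simp [G, h1, h2])
    rw [Finset.card_erase_of_mem hv, hA] at this
    simpa [G] using this
  calc M ^ n * F.card
      ≤ M ^ n * ∑ v ∈ A, ∑ s ∈ range M, (Fintype.piFinset (G v s)).card := by
        gcongr
        exact (card_le_card hcov).trans
          (card_biUnion_le.trans (sum_le_sum fun A _ => card_biUnion_le))
    _ = ∑ v ∈ A, ∑ s ∈ range M, M ^ n * (Fintype.piFinset (G v s)).card := by
          simp only [mul_sum]
    _ ≤ ∑ v ∈ A, ∑ s ∈ range M, M ^ Fintype.card V * L ^ (n - 1) :=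
          sum_le_sum fun v hv => sum_le_sum fun s _ => h2 v hv s
    _ = _ := by simp [hA]; ring

lemma count_long {V : Type} [Fintype V] [DecidableEq V] (n M L R : ℕ)
    (hn : 2 ≤ n) (D : ℕ → Finset V) (e : ℕ → V) (t l : ℕ → ℕ)
    (hD : ∀ i < R + 1, (D i).card = n - 1)
    (hdisj : ∀ i < R + 1, ∀ j < R + 1, i ≠ j → Disjoint (D i) (D j))
    (he : ∀ i < R, e i ∈ D i) (hl : ∀ i < R + 1, t (i + 1) + 1 = t i + l i)
    (hL : ∀ i < R + 1, L ≤ l i) (F : Finset (V → ℕ))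
    (hF : ∀ x ∈ F, (∀ w, x w < M) ∧ (∀ i < R + 1, ∀ w ∈ D i, t i ≤ x w ∧ x w ≤ t (i + 1)) ∧
      ∀ i < R, x (e i) = t (i + 1)) :
    L ^ R * (M ^ ((R + 1) * (n - 1)) * F.card) ≤
      M ^ Fintype.card V * ∏ i ∈ range (R + 1), l i ^ (n - 1) := by
  classical
  let G : V → Finset ℕ := fun w => (range M).filter (fun y => ∀ i < R + 1, w ∈ D i →
    (t i ≤ y ∧ y ≤ t (i + 1)) ∧ (i < R → w = e i → y = t (i + 1)))
  have hcov : F ⊆ Fintype.piFinset G := by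
    intro x hx
    obtain ⟨h1, h2, h3⟩ := hF x hx
    simp only [Fintype.mem_piFinset, G, mem_filter, mem_range]
    refine fun w => ⟨h1 w, fun i hi hw => ⟨h2 i hi w hw, fun hi' hwe => ?_⟩⟩
    rw [hwe]; exact h3 i hi'
  have hpd : Set.PairwiseDisjoint (↑(range (R + 1)) : Set ℕ) D := by
    intro i hi j hj hij
    exact hdisj i (by simpa using hi) j (by simpa using hj) hij
  let U := (range (R + 1)).biUnion D
  have hU : U.card = (R + 1) * (n - 1) := by
    rw [Finset.card_biUnion hpd]
    rw [Finset.sum_congr rfl (fun i hi => hD i (by simpa using hi))]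
    simp
  have hmain := H_count G U M (fun w _ => by
    simpa using card_filter_le (range M) _)
  rw [hU, Finset.prod_biUnion hpd] at hmain
  have hGi : ∀ i < R + 1, ∀ w ∈ D i, (G w).card ≤ l i := by
    intro i hi w hw
    have : G w ⊆ Ico (t i) (t i + l i) := by
      intro y hy
      simp only [G, mem_filter] at hy
      have := (hy.2 i hi hw).1
      have := hl i hi
      simp; omega
    simpa using card_le_card this
  have hGe : ∀ i < R, (G (e i)).card ≤ 1 := by
    intro i hi
    have : G (e i) ⊆ {t (i + 1)} := by
      intro y hy
      simp only [G, mem_filter] at hy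
      simpa using (hy.2 i (by omega) (he i hi)).2 hi rfl
    simpa using card_le_card this
  have hprod : ∀ i < R, L * ∏ w ∈ D i, (G w).card ≤ l i ^ (n - 1) := by
    intro i hi
    rw [← Finset.mul_prod_erase (D i) _ (he i hi)]
    have : ∏ w ∈ (D i).erase (e i), (G w).card ≤ l i ^ ((D i).erase (e i)).card :=
      Finset.prod_le_pow_card _ _ _
        (fun w hw => hGi i (by omega) w (Finset.mem_of_mem_erase hw))
    rw [Finset.card_erase_of_mem (he i hi), hD i (by omega)] at this
    calc _ ≤ l i * (1 * l i ^ (n - 1 - 1)) := by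
          gcongr
          · exact hL i (by omega)
          · exact hGe i hi
      _ = l i ^ (n - 1 - 1 + 1) := by ring
      _ = _ := by congr 1; omega
  have hlast : ∏ w ∈ D R, (G w).card ≤ l R ^ (n - 1) := by
    rw [← hD R (by omega)]
    exact Finset.prod_le_pow_card _ _ _ (fun w hw => hGi R (by omega) w hw)
  have hcardle := card_le_card hcov
  have hpr : ∏ i ∈ range R, (L * ∏ w ∈ D i, (G w).card) ≤ ∏ i ∈ range R, l i ^ (n - 1) :=
    Finset.prod_le_prod' (fun i hi => hprod i (by simpa using hi))
  rw [prod_mul_distrib, prod_const, card_range] at hpr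
  rw [prod_range_succ] at hmain
  rw [prod_range_succ]
  clear_value G
  generalize (Fintype.piFinset G).card = c1 at *
  generalize (∏ i ∈ range R, ∏ w ∈ D i, (G w).card) = c2 at *
  generalize (∏ w ∈ D R, (G w).card) = c3 at *
  generalize (∏ i ∈ range R, l i ^ (n - 1)) = c4 at *
  generalize l R ^ (n - 1) = c5 at *
  generalize M ^ ((R + 1) * (n - 1)) = c6 at *
  generalize M ^ Fintype.card V = c7 at *
  generalize L ^ R = c8 at *
  calc c8 * (c6 * F.card) ≤ c8 * (c6 * c1) := by gcongr
    _ ≤ c8 * (c7 * (c2 * c3)) := by gcongr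
    _ = c7 * ((c8 * c2) * c3) := by ring
    _ ≤ c7 * (c4 * c5) := by gcongr

lemma amgm (R : ℕ) (z : ℕ → ℝ) (hz : ∀ i, 0 ≤ z i) :
    ∏ i ∈ range (R + 1), z i ≤ ((∑ i ∈ range (R + 1), z i) / (R + 1)) ^ (R + 1) := by
  have h := Real.geom_mean_le_arith_mean (range (R + 1)) (fun _ => 1) z (by simp) (by simp; positivity)
    (fun i _ => hz i)
  simp only [Real.rpow_one, one_mul, sum_const, card_range, nsmul_eq_mul, mul_one] at h
  have h0 : 0 ≤ ∏ i ∈ range (R + 1), z i := prod_nonneg fun i _ => hz i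
  have h2 := pow_le_pow_left₀ (by positivity) h (R + 1)
  rw [Real.rpow_inv_natCast_pow h0 (by omega)] at h2
  simpa using h2

abbrev lkey {V : Type} (x : V → ℕ) (v : V) : ℕ ×ₗ V := toLex (x v, v)

def Ev {V : Type} [LinearOrder V] (E : Finset (Finset V)) (M L r : ℕ) (B : Fin r → Finset V)
    (x : V → ℕ) : Prop :=
  (∀ w, x w < M) ∧ ∃ A u, (∀ i : Fin r, A i = B i) ∧ IsChn E (lkey x) A u r ∧
    ∀ i < r, x (u i) + L ≤ x (u (i + 1))

lemma lkey_le {V : Type} [LinearOrder V] {x : V → ℕ} {v w : V} (h : lkey x v ≤ lkey x w) :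
    x v ≤ x w := by
  rw [Prod.Lex.le_iff] at h
  simp at h
  omega

lemma lkey_inj {V : Type} {x : V → ℕ} {v w : V} (h : lkey x v = lkey x w) :
    v = w := by
  simpa using congrArg (fun z => (ofLex z).2) h

lemma chn_mono {V K : Type} [LinearOrder K] {E : Finset (Finset V)} {key : V → K}
    {A : ℕ → Finset V} {u : ℕ → V} {s : ℕ} (h : IsChn E key A u s) (i j : ℕ) (hij : i ≤ j)
    (hj : j ≤ s) : key (u i) ≤ key (u j) := by
  induction j, hij using Nat.le_induction with
  | base => exact le_rfl
  | succ j hij ih =>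
    refine (ih (by omega)).trans ?_
    obtain ⟨_, h2, _, h4⟩ := h j (by omega)
    exact (h4 _ h2).2

lemma count_Ev {V : Type} [Fintype V] [LinearOrder V] (E : Finset (Finset V)) (n M L R : ℕ)
    (hn : 2 ≤ n) (hE : ∀ A ∈ E, A.card = n) (B : Fin (R + 1) → Finset V)
    (hPM : (R + 1) * L < M)
    (F : Finset (V → ℕ)) (hF : ∀ x ∈ F, Ev E M L (R + 1) B x) :
    ((L : ℝ) + 1) ^ R * ((M : ℝ) ^ ((R + 1) * (n - 1)) * F.card) ≤
      ((M - 1 - (R + 1) * L + R).choose R) *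
      ((M : ℝ) ^ Fintype.card V * (((M : ℝ) + R) / (R + 1)) ^ ((R + 1) * (n - 1))) := by
  classical
  rcases F.eq_empty_or_nonempty with rfl | ⟨x0, hx0⟩
  · simp; positivity
  obtain ⟨hM0, A0, u0, hAB0, hch0, -⟩ := hF x0 hx0
  -- basic structure
  let D : ℕ → Finset V := fun i => (A0 i).erase (u0 i)
  let e : ℕ → V := fun i => u0 (i + 1)
  let S := M - 1 - (R + 1) * L
  let t : (ℕ →₀ ℕ) → ℕ → ℕ := fun s i => ∑ j ∈ range i, (L + s j)
  let FF : (ℕ →₀ ℕ) → Finset (V → ℕ) := fun s => F.filter (fun x =>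
    (∀ i < R + 1, ∀ w ∈ D i, t s i ≤ x w ∧ x w ≤ t s (i + 1)) ∧ ∀ i < R, x (e i) = t s (i + 1))
  have hD : ∀ i < R + 1, (D i).card = n - 1 := by
    intro i hi
    obtain ⟨h1, h2, _, _⟩ := hch0 i hi
    simp only [D]
    rw [card_erase_of_mem h2, hE _ h1]
  have hDk : ∀ i < R + 1, ∀ w ∈ D i, lkey x0 (u0 i) < lkey x0 w ∧
      lkey x0 w ≤ lkey x0 (u0 (i + 1)) := by
    intro i hi w hw
    obtain ⟨h1, h2, _, h4⟩ := hch0 i hi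
    have hw1 := ne_of_mem_erase hw
    have hw2 := mem_of_mem_erase hw
    refine ⟨lt_of_le_of_ne (h4 w hw2).1 (fun h => hw1 (lkey_inj h).symm), (h4 w hw2).2⟩
  have hdisj' : ∀ i < R + 1, ∀ j < R + 1, i < j → Disjoint (D i) (D j) := by
    intro i hi j hj hij
    rw [Finset.disjoint_left]
    intro w hwi hwj
    have h1 := (hDk i hi w hwi).2
    have h2 := (hDk j hj w hwj).1
    have h3 := chn_mono hch0 (i + 1) j hij hj.le
    exact absurd (h1.trans h3) (not_le.mpr h2)
  have hdisj : ∀ i < R + 1, ∀ j < R + 1, i ≠ j → Disjoint (D i) (D j) := by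
    intro i hi j hj hij
    rcases lt_or_gt_of_ne hij with h | h
    · exact hdisj' i hi j hj h
    · exact (hdisj' j hj i hi h).symm
  have he : ∀ i < R, e i ∈ D i := by
    intro i hi
    obtain ⟨h1, h2, h3, h4⟩ := hch0 i (by omega)
    simp only [e, D, mem_erase]
    refine ⟨?_, h3⟩
    intro heq
    obtain ⟨w, hw⟩ : (D i).Nonempty := by
      rw [← card_pos, hD i (by omega)]; omega
    have := hDk i (by omega) w hw
    rw [heq] at this
    exact absurd this.2 (not_le.mpr this.1)
  have hcov : F ⊆ (finsuppAntidiag (range (R + 1)) S).biUnion FF := by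
    intro x hx
    obtain ⟨hM, A, u, hAB, hch, hsp⟩ := hF x hx
    have hAA : ∀ i < R + 1, A i = A0 i := fun i hi =>
      (hAB ⟨i, hi⟩).trans (hAB0 ⟨i, hi⟩).symm
    have hu : ∀ i < R, u (i + 1) = u0 (i + 1) := by
      intro i hi
      have a1 := hch i (by omega)
      have a2 := hch (i + 1) (by omega)
      have b1 := hch0 i (by omega)
      have b2 := hch0 (i + 1) (by omega)
      rw [hAA i (by omega)] at a1
      rw [hAA (i + 1) (by omega)] at a2
      refine lkey_inj (x := x) (le_antisymm ?_ ?_)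
      · exact (a2.2.2.2 _ b2.2.1).1
      · exact (a1.2.2.2 _ b1.2.2.1).2
    let t' : ℕ → ℕ := fun i => if i = 0 then 0 else if i < R + 1 then x (u i) else M - 1
    have ht0 : t' 0 = 0 := by simp [t']
    have ht1 : ∀ i < R, t' (i + 1) = x (u (i + 1)) := by
      intro i hi
      simp [t', hi]
    have ht2 : t' (R + 1) = M - 1 := by simp [t']
    have ht4 : ∀ i < R + 1, t' i ≤ x (u i) := by
      intro i hi
      rcases i with _ | i
      · rw [ht0]; exact Nat.zero_le _
      · rw [ht1 i (by omega)]
    have ht5 : ∀ i < R + 1, x (u (i + 1)) ≤ t' (i + 1) := by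
      intro i hi
      rcases Nat.lt_succ_iff_lt_or_eq.mp hi with h | h
      · rw [ht1 i h]
      · rw [h, ht2]
        have := hM (u (R + 1))
        omega
    have ht' : ∀ i < R + 1, t' i + L ≤ t' (i + 1) := by
      intro i hi
      have h1 := hsp i hi
      have h2 := hM (u (i + 1))
      have h3 : t' i ≤ x (u i) := ht4 i (by omega)
      have h4 := ht5 i hi
      omega
    let s : ℕ →₀ ℕ := Finsupp.onFinset (range (R + 1))
      (fun i => if i < R + 1 then t' (i + 1) - t' i - L else 0) (by
        intro i hi
        by_contra h
        simp at h
        apply hi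
        rw [if_neg (by omega)])
    have hs : ∀ i < R + 1, s i = t' (i + 1) - t' i - L := by
      intro i hi
      simp only [s, Finsupp.onFinset_apply, if_pos hi]
    have htt : ∀ i ≤ R + 1, t s i = t' i := by
      intro i
      induction i with
      | zero => intro _; simp [t, t']
      | succ i ih =>
        intro hi
        have h1 := ih (by omega)
        have h2 : t s (i + 1) = t s i + (L + s i) := by simp only [t, sum_range_succ]
        have h3 := hs i (by omega)
        have h4 := ht' i (by omega)
        omega
    simp only [mem_biUnion]
    refine ⟨s, ?_, ?_⟩
    · rw [mem_finsuppAntidiag]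
      refine ⟨?_, Finsupp.support_onFinset_subset⟩
      have h1 := htt (R + 1) le_rfl
      have h2 : t s (R + 1) = (R + 1) * L + ∑ j ∈ range (R + 1), s j := by
        simp only [t, sum_add_distrib]; simp
      simp only [S]
      rw [h2, ht2] at h1
      change ∑ j ∈ range (R + 1), s j = _
      generalize (R + 1) * L = P at h1 ⊢
      omega
    · simp only [FF, mem_filter]
      refine ⟨hx, ?_, ?_⟩
      · intro i hi w hw
        rw [htt i (by omega), htt (i + 1) (by omega)]
        have hw2 : w ∈ A i := by rw [hAA i hi]; exact mem_of_mem_erase hw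
        obtain ⟨_, _, _, h4⟩ := hch i hi
        have h5 := lkey_le (h4 w hw2).1
        have h6 := lkey_le (h4 w hw2).2
        have h7 := hM w
        exact ⟨(ht4 i hi).trans h5, h6.trans (ht5 i hi)⟩
      · intro i hi
        rw [htt (i + 1) (by omega)]
        simp only [e]
        rw [← hu i hi, ht1 i hi]
  have hone : ∀ s ∈ finsuppAntidiag (range (R + 1)) S,
      ((L : ℝ) + 1) ^ R * ((M : ℝ) ^ ((R + 1) * (n - 1)) * (FF s).card) ≤
      ((M : ℝ) ^ Fintype.card V * (((M : ℝ) + R) / (R + 1)) ^ ((R + 1) * (n - 1))) := by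
    intro s hs
    have hc := count_long n M (L + 1) R hn D e (t s) (fun i => L + 1 + s i) hD hdisj he
      (fun i hi => by simp only [t, sum_range_succ]; ring)
      (fun i hi => by omega) (FF s) (by
        intro x hx
        simp only [FF, mem_filter] at hx
        exact ⟨(hF x hx.1).1, hx.2⟩)
    have hc' : ((L : ℝ) + 1) ^ R * ((M : ℝ) ^ ((R + 1) * (n - 1)) * (FF s).card) ≤
        (M : ℝ) ^ Fintype.card V * ∏ i ∈ range (R + 1), ((L : ℝ) + 1 + s i) ^ (n - 1) := by
      exact_mod_cast hc
    refine hc'.trans ?_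
    gcongr
    rw [prod_pow, pow_mul]
    refine pow_le_pow_left₀ (prod_nonneg fun i _ => by positivity) ?_ _
    refine (amgm R (fun i => (L : ℝ) + 1 + s i) (fun i => by positivity)).trans_eq ?_
    congr 2
    rw [mem_finsuppAntidiag] at hs
    have h2 : ∑ j ∈ range (R + 1), ((L : ℝ) + 1 + s j) = (R + 1) * (L + 1) + S := by
      rw [sum_add_distrib, ← hs.1]; simp; ring
    rw [h2]
    have h3 : (R + 1) * L + S + 1 = M := by
      simp only [S]
      generalize (R + 1) * L = P at hPM ⊢
      omega
    have h4 : ((R : ℝ) + 1) * L + S + 1 = M := by exact_mod_cast h3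
    linarith
  have hcard : (F.card : ℝ) ≤ ∑ s ∈ finsuppAntidiag (range (R + 1)) S, ((FF s).card : ℝ) := by
    exact_mod_cast (card_le_card hcov).trans card_biUnion_le
  have hnum : (finsuppAntidiag (range (R + 1)) S).card = (S + R).choose R := by
    rw [card_finsuppAntidiag_nat_eq_choose, card_range]
    rw [show R + 1 + S - 1 = S + R by omega]
    exact Nat.choose_symm_add
  calc _ ≤ ((L : ℝ) + 1) ^ R * ((M : ℝ) ^ ((R + 1) * (n - 1)) *
        ∑ s ∈ finsuppAntidiag (range (R + 1)) S, ((FF s).card : ℝ)) := by gcongr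
    _ = ∑ s ∈ finsuppAntidiag (range (R + 1)) S, ((L : ℝ) + 1) ^ R *
        ((M : ℝ) ^ ((R + 1) * (n - 1)) * (FF s).card) := by simp only [mul_sum]
    _ ≤ _ := sum_le_card_nsmul _ _ _ hone
    _ = _ := by rw [hnum, nsmul_eq_mul]

lemma main_ineq {V : Type} [Fintype V] [LinearOrder V] (E : Finset (Finset V)) (n M L R : ℕ)
    (hn : 2 ≤ n) (hE : ∀ A ∈ E, A.card = n) (hPM : (R + 1) * L < M)
    (hchrom : ∀ c : V → Fin (R + 1), ∃ A ∈ E, ∃ i : Fin (R + 1), ∀ v ∈ A, c v = i) :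
    (1 : ℝ) ≤ E.card * n * ((L : ℝ) / M) ^ (n - 1) +
      (E.card : ℝ) ^ (R + 1) * ((M - 1 - (R + 1) * L + R).choose R) *
      (((M : ℝ) + R) / (R + 1) / M) ^ ((R + 1) * (n - 1)) / ((L : ℝ) + 1) ^ R := by
  classical
  have hM : 0 < M := by omega
  let Ω : Finset (V → ℕ) := Fintype.piFinset (fun _ => range M)
  let F1 : Finset V → Finset (V → ℕ) := fun A =>
    Ω.filter (fun x => ∃ v ∈ A, ∀ w ∈ A, x v ≤ x w ∧ x w < x v + L)
  let F2 : (Fin (R + 1) → Finset V) → Finset (V → ℕ) := fun B =>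
    Ω.filter (fun x => Ev E M L (R + 1) B x)
  have hcov : Ω ⊆ E.biUnion F1 ∪ (Fintype.piFinset (fun _ : Fin (R + 1) => E)).biUnion F2 := by
    intro x hx
    obtain ⟨A, u, hch⟩ := exists_chain (R + 1) E (lkey x)
      (fun A hA => by rw [← card_pos, hE A hA]; omega) hchrom
    rw [mem_union]
    by_cases h : ∃ i < R + 1, x (u (i + 1)) < x (u i) + L
    · left
      obtain ⟨i, hi, hlt⟩ := h
      obtain ⟨h1, h2, h3, h4⟩ := hch i hi
      rw [mem_biUnion]
      refine ⟨A i, h1, ?_⟩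
      simp only [F1, mem_filter]
      refine ⟨hx, u i, h2, fun w hw => ⟨lkey_le (h4 w hw).1, ?_⟩⟩
      exact lt_of_le_of_lt (lkey_le (h4 w hw).2) hlt
    · right
      push Not at h
      rw [mem_biUnion]
      refine ⟨fun i => A i, ?_, ?_⟩
      · rw [Fintype.mem_piFinset]
        exact fun i => (hch i i.2).1
      · simp only [F2, mem_filter]
        refine ⟨hx, ?_, A, u, fun _ => rfl, hch, h⟩
        simpa [Ω, Fintype.mem_piFinset] using hx
  have hΩ : Ω.card = M ^ Fintype.card V := by simp [Ω]
  have hcard : ((M : ℝ) ^ Fintype.card V) ≤ ∑ A ∈ E, ((F1 A).card : ℝ) +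
      ∑ B ∈ Fintype.piFinset (fun _ : Fin (R + 1) => E), ((F2 B).card : ℝ) := by
    have h1 := (card_le_card hcov).trans (card_union_le _ _)
    have h2 := h1.trans (add_le_add card_biUnion_le card_biUnion_le)
    rw [hΩ] at h2
    exact_mod_cast h2
  have hMr : (0 : ℝ) < M := by exact_mod_cast hM
  have hb1 : ∀ A ∈ E, ((F1 A).card : ℝ) ≤
      (M : ℝ) ^ Fintype.card V * (n * ((L : ℝ) / M) ^ (n - 1)) := by
    intro A hA
    have h := count_short A n M L (hE A hA) (F1 A) (fun x hx => by
      simp only [F1, mem_filter] at hx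
      exact ⟨by simpa [Ω, Fintype.mem_piFinset] using hx.1, hx.2⟩)
    have h' : (M : ℝ) ^ n * ((F1 A).card : ℝ) ≤
      n * M * (M ^ Fintype.card V * L ^ (n - 1)) := by exact_mod_cast h
    obtain ⟨k, rfl⟩ : ∃ k, n = k + 1 := ⟨n - 1, by omega⟩
    simp only [Nat.add_sub_cancel] at *
    rw [div_pow]
    rw [pow_succ] at h'
    have : (M : ℝ) ^ Fintype.card V * (((k + 1 : ℕ) : ℝ) * ((L : ℝ) ^ k / M ^ k)) =
      (((k + 1 : ℕ) : ℝ) * M * (M ^ Fintype.card V * L ^ k)) / (M ^ k * M) := by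
      field_simp
    rw [this, le_div_iff₀ (by positivity)]
    linarith
  have hb2 : ∀ B, ((F2 B).card : ℝ) ≤ (M : ℝ) ^ Fintype.card V *
      (((M - 1 - (R + 1) * L + R).choose R) *
      (((M : ℝ) + R) / (R + 1) / M) ^ ((R + 1) * (n - 1)) / ((L : ℝ) + 1) ^ R) := by
    intro B
    have h := count_Ev E n M L R hn hE B hPM (F2 B) (fun x hx => by
      simp only [F2, mem_filter] at hx
      exact hx.2)
    rw [div_pow _ (M : ℝ)]
    generalize (((M - 1 - (R + 1) * L + R).choose R : ℕ) : ℝ) = c1 at *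
    generalize (((M : ℝ) + R) / (R + 1)) ^ ((R + 1) * (n - 1)) = c2 at *
    have hc3 : (0 : ℝ) < (M : ℝ) ^ ((R + 1) * (n - 1)) := by positivity
    generalize (M : ℝ) ^ ((R + 1) * (n - 1)) = c3 at *
    have hc4 : (0 : ℝ) < ((L : ℝ) + 1) ^ R := by positivity
    generalize ((L : ℝ) + 1) ^ R = c4 at *
    have : (M : ℝ) ^ Fintype.card V * (c1 * (c2 / c3) / c4) =
      (c1 * ((M : ℝ) ^ Fintype.card V * c2)) / (c4 * c3) := by
      field_simp
    rw [this, le_div_iff₀ (by positivity)]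
    linarith
  have h1 := sum_le_card_nsmul _ _ _ hb1
  have h2 := sum_le_card_nsmul (Fintype.piFinset (fun _ : Fin (R + 1) => E)) _ _
    (fun B _ => hb2 B)
  have hcp : (Fintype.piFinset (fun _ : Fin (R + 1) => E)).card = E.card ^ (R + 1) := by simp
  rw [hcp] at h2
  simp only [nsmul_eq_mul, Nat.cast_pow] at h1 h2
  have hV : (0 : ℝ) < (M : ℝ) ^ Fintype.card V := by positivity
  have h3 := hcard.trans (add_le_add h1 h2)
  refine le_of_mul_le_mul_left ?_ hV
  rw [mul_one]
  refine h3.trans_eq ?_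
  ring

lemma ineq_M {V : Type} [Fintype V] [LinearOrder V] (E : Finset (Finset V)) (n M R : ℕ)
    (hn : 2 ≤ n) (hE : ∀ A ∈ E, A.card = n) (hM : 0 < M) (q : ℝ) (hq : 0 < q)
    (hchrom : ∀ c : V → Fin (R + 1), ∃ A ∈ E, ∃ i : Fin (R + 1), ∀ v ∈ A, c v = i) :
    (1 : ℝ) ≤ E.card * n * (1 / ((R + 1) * (1 + q))) ^ (n - 1) +
      (E.card : ℝ) ^ (R + 1) *
      ((1 + R * (1 / (M : ℝ))) / (R + 1)) ^ ((R + 1) * (n - 1)) *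
      ((R + 1) * q + 2 * (R + 1) ^ 2 * (1 + q) * (1 / (M : ℝ))) ^ R / R.factorial := by
  have hMr : (0 : ℝ) < M := by exact_mod_cast hM
  set L := ⌊(M : ℝ) / ((R + 1) * (1 + q))⌋₊ with hL
  have hL1 : (L : ℝ) ≤ (M : ℝ) / ((R + 1) * (1 + q)) := Nat.floor_le (by positivity)
  have hL2 : (M : ℝ) / ((R + 1) * (1 + q)) < L + 1 := Nat.lt_floor_add_one _
  rw [le_div_iff₀ (by positivity)] at hL1
  rw [div_lt_iff₀ (by positivity)] at hL2
  have hPM : (R + 1) * L < M := by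
    have : ((R : ℝ) + 1) * L < M := by
      by_cases h0 : (L : ℝ) = 0
      · rw [h0]; simpa using hM
      · have : (0 : ℝ) < L := lt_of_le_of_ne (Nat.cast_nonneg _) (Ne.symm h0)
        have : 0 < ((R : ℝ) + 1) * L * q := by positivity
        nlinarith
    exact_mod_cast this
  have h := main_ineq E n M L R hn hE hPM hchrom
  refine h.trans ?_
  have hS : (((M - 1 - (R + 1) * L + R : ℕ) : ℝ)) ≤
      ((R + 1) * q + 2 * (R + 1) ^ 2 * (1 + q) * (1 / (M : ℝ))) * (L + 1) := by
    have e1 : (M - 1 - (R + 1) * L + R) + 1 + (R + 1) * L = M + R := by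
      generalize (R + 1) * L = P at *
      omega
    have e2 : (((M - 1 - (R + 1) * L + R : ℕ) : ℝ)) + 1 + (R + 1) * L = M + R := by
      exact_mod_cast e1
    have e3 : ((R : ℝ) + 1) * q * (L + 1) ≥ M - (R + 1) * (L + 1) := by nlinarith
    have e4 : 2 * ((R : ℝ) + 1) ^ 2 * (1 + q) * (1 / (M : ℝ)) * (L + 1) ≥ 2 * (R + 1) := by
      have : 2 * ((R : ℝ) + 1) ^ 2 * (1 + q) * (1 / (M : ℝ)) * (L + 1)
        = (2 * (R + 1)) * (((L + 1) * ((R + 1) * (1 + q))) / M) := by field_simp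
      rw [this]
      have : 1 ≤ ((L + 1) * (((R : ℝ) + 1) * (1 + q))) / M := by
        rw [le_div_iff₀ hMr]; linarith
      have h0 : (0 : ℝ) ≤ 2 * (R + 1) := by positivity
      nlinarith
    nlinarith
  have hch : (((M - 1 - (R + 1) * L + R).choose R : ℕ) : ℝ) ≤
      (((R + 1) * q + 2 * (R + 1) ^ 2 * (1 + q) * (1 / (M : ℝ))) * (L + 1)) ^ R / R.factorial := by
    refine (Nat.choose_le_pow_div R _).trans ?_
    gcongr
  have ht1 : (L : ℝ) / M ≤ 1 / ((R + 1) * (1 + q)) := by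
    rw [div_le_div_iff₀ hMr (by positivity)]; linarith
  refine add_le_add (by gcongr) ?_
  have e5 : ((M : ℝ) + R) / (R + 1) / M = (1 + R * (1 / (M : ℝ))) / (R + 1) := by field_simp
  rw [e5]
  have hc2 : 0 ≤ ((1 + R * (1 / (M : ℝ))) / (R + 1)) ^ ((R + 1) * (n - 1)) := by positivity
  generalize ((1 + R * (1 / (M : ℝ))) / (R + 1)) ^ ((R + 1) * (n - 1)) = c2 at *
  generalize (((M - 1 - (R + 1) * L + R).choose R : ℕ) : ℝ) = c1 at *
  rw [mul_pow] at hch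
  generalize ((R + 1) * q + 2 * (R + 1) ^ 2 * (1 + q) * (1 / (M : ℝ))) ^ R = c3 at *
  rw [div_le_iff₀ (by positivity)]
  calc (E.card : ℝ) ^ (R + 1) * c1 * c2
      ≤ (E.card : ℝ) ^ (R + 1) * (c3 * ((L : ℝ) + 1) ^ R / R.factorial) * c2 := by gcongr
    _ = _ := by ring

lemma ineq_lim {V : Type} [Fintype V] [LinearOrder V] (E : Finset (Finset V)) (n R : ℕ)
    (hn : 2 ≤ n) (hE : ∀ A ∈ E, A.card = n) (q : ℝ) (hq : 0 < q)
    (hchrom : ∀ c : V → Fin (R + 1), ∃ A ∈ E, ∃ i : Fin (R + 1), ∀ v ∈ A, c v = i) :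
    (1 : ℝ) ≤ E.card * n * (1 / ((R + 1) * (1 + q))) ^ (n - 1) +
      (E.card : ℝ) ^ (R + 1) * (1 / (R + 1)) ^ ((R + 1) * (n - 1)) *
      ((R + 1) * q) ^ R / R.factorial := by
  let f : ℝ → ℝ := fun z => E.card * n * (1 / ((R + 1) * (1 + q))) ^ (n - 1) +
      (E.card : ℝ) ^ (R + 1) *
      ((1 + R * z) / (R + 1)) ^ ((R + 1) * (n - 1)) *
      ((R + 1) * q + 2 * (R + 1) ^ 2 * (1 + q) * z) ^ R / R.factorial
  have hf : Continuous f := by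
    simp only [f]
    fun_prop
  have ht : Filter.Tendsto (fun M : ℕ => f (1 / (M : ℝ))) Filter.atTop (nhds (f 0)) :=
    (hf.tendsto 0).comp tendsto_one_div_atTop_nhds_zero_nat
  have h1 : (1 : ℝ) ≤ f 0 := by
    refine ge_of_tendsto ht ?_
    filter_upwards [Filter.eventually_gt_atTop 0] with M hM
    exact ineq_M E n M R hn hE hM q hq hchrom
  simpa [f] using h1

/-- second term -/
lemma term2 (y : ℝ) (hy : 2 ≤ y) (R : ℕ) (hR : 2 ≤ R) :
    y ^ 2 / 4 * (2 * (R + 1) / (3 * y)) ^ R / R.factorial ≤ 1 / 2 := by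
  induction R, hR using Nat.le_induction with
  | base =>
    simp [Nat.factorial]
    field_simp
    norm_num
  | succ R hR ih =>
    refine le_trans ?_ ih
    have hR0 : (0 : ℝ) < (R : ℝ) + 1 := by positivity
    have he : (1 + 1 / ((R : ℝ) + 1)) ^ (R + 1) ≤ 3 := by
      have h1 : 1 + 1 / ((R : ℝ) + 1) ≤ Real.exp (1 / ((R : ℝ) + 1)) := by
        have := Real.add_one_le_exp (1 / ((R : ℝ) + 1)); linarith
      calc (1 + 1 / ((R : ℝ) + 1)) ^ (R + 1) ≤ (Real.exp (1 / ((R : ℝ) + 1))) ^ (R + 1) := by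
            gcongr
        _ = Real.exp 1 := by
            rw [← Real.exp_nat_mul]; congr 1; push_cast; field_simp
        _ ≤ 3 := by have := Real.exp_one_lt_d9; linarith
    have e1 : (2 * (((R + 1 : ℕ) : ℝ) + 1) / (3 * y)) ^ (R + 1) =
        (1 + 1 / ((R : ℝ) + 1)) ^ (R + 1) * (2 * ((R : ℝ) + 1) / (3 * y)) ^ R *
          (2 * ((R : ℝ) + 1) / (3 * y)) := by
      rw [mul_assoc, ← pow_succ, ← mul_pow]
      congr 1
      push_cast
      field_simp
    rw [e1, Nat.factorial_succ]
    push_cast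
    have hX : (0 : ℝ) ≤ y ^ 2 / 4 * (2 * ((R : ℝ) + 1) / (3 * y)) ^ R / R.factorial := by positivity
    have e2 : y ^ 2 / 4 * ((1 + 1 / ((R : ℝ) + 1)) ^ (R + 1) *
        (2 * ((R : ℝ) + 1) / (3 * y)) ^ R * (2 * ((R : ℝ) + 1) / (3 * y))) /
        (((R : ℝ) + 1) * R.factorial) =
        (y ^ 2 / 4 * (2 * ((R : ℝ) + 1) / (3 * y)) ^ R / R.factorial) *
        ((1 + 1 / ((R : ℝ) + 1)) ^ (R + 1) * (2 / (3 * y))) := by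
      generalize (1 + 1 / ((R : ℝ) + 1)) ^ (R + 1) = c
      generalize (2 * ((R : ℝ) + 1) / (3 * y)) ^ R = d
      field_simp
    rw [e2]
    refine mul_le_of_le_one_right hX ?_
    calc (1 + 1 / ((R : ℝ) + 1)) ^ (R + 1) * (2 / (3 * y)) ≤ 3 * (2 / (3 * 2)) := by gcongr
      _ = 1 := by norm_num

lemma term1 (y : ℝ) (hy : 2 ≤ y) (n : ℕ) (hn : (n : ℝ) = y ^ 4) :
    y ^ 6 / 4 * (1 / (1 + 8 / 3 / y ^ 3)) ^ (n - 1) < 1 / 2 := by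
  have hy0 : 0 < y := by linarith
  set q := 8 / 3 / y ^ 3 with hq
  have hq0 : 0 < q := by positivity
  have hy3 : (8 : ℝ) ≤ y ^ 3 := by
    calc (8 : ℝ) = 2 ^ 3 := by norm_num
      _ ≤ y ^ 3 := by gcongr
  have hy4 : (16 : ℝ) ≤ y ^ 4 := by
    calc (16 : ℝ) = 2 ^ 4 := by norm_num
      _ ≤ y ^ 4 := by gcongr
  have hq1 : q ≤ 1 / 3 := by
    rw [hq, div_le_iff₀ (by positivity)]; linarith
  have hn1 : 1 ≤ n := by
    have : (1 : ℝ) ≤ n := by rw [hn]; linarith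
    exact_mod_cast this
  have hlog : 6 / 7 * q ≤ Real.log (1 + q) := by
    refine le_trans ?_ (Real.le_log_one_add_of_nonneg hq0.le)
    rw [le_div_iff₀ (by linarith)]
    nlinarith
  have hz : 15 / 7 * y ≤ ((n - 1 : ℕ) : ℝ) * Real.log (1 + q) := by
    have h1 : ((n - 1 : ℕ) : ℝ) = y ^ 4 - 1 := by rw [Nat.cast_sub hn1, hn]; simp
    rw [h1]
    have h2 : 15 / 16 * y ^ 4 ≤ y ^ 4 - 1 := by linarith
    calc 15 / 7 * y = 15 / 16 * y ^ 4 * (6 / 7 * q) := by rw [hq]; field_simp; norm_num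
      _ ≤ (y ^ 4 - 1) * Real.log (1 + q) := by gcongr; linarith
  have hexp : Real.exp (15 / 7 * y) ≤ (1 + q) ^ (n - 1) := by
    calc _ ≤ Real.exp (((n - 1 : ℕ) : ℝ) * Real.log (1 + q)) := Real.exp_le_exp.mpr hz
      _ = _ := by rw [Real.exp_nat_mul, Real.exp_log (by linarith)]
  have hexp2 : 5 / 14 * y * 2.7 ≤ Real.exp (5 / 14 * y) := by
    have h1 := Real.add_one_le_exp (5 / 14 * y - 1)
    have h2 : Real.exp (5 / 14 * y) = Real.exp (5 / 14 * y - 1) * Real.exp 1 := by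
      rw [← Real.exp_add]; congr 1; ring
    rw [h2]
    have := Real.exp_one_gt_d9
    gcongr
    · linarith
    · linarith
  have hexp3 : (5 / 14 * y * 2.7) ^ 6 ≤ Real.exp (15 / 7 * y) := by
    calc _ ≤ (Real.exp (5 / 14 * y)) ^ 6 := by gcongr
      _ = _ := by rw [← Real.exp_nat_mul]; congr 1; push_cast; ring
  have h4 := hexp3.trans hexp
  rw [one_div, inv_pow, ← div_eq_mul_inv, div_lt_iff₀ (by positivity)]
  have h5 : (5 / 14 * y * 2.7) ^ 6 = (5 / 14 * 2.7) ^ 6 * y ^ 6 := by ring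
  rw [h5] at h4
  have hy6 : 0 < y ^ 6 := by positivity
  norm_num at h4 ⊢
  linarith

theorem stmt_10 (n r : ℕ) (hn : 2 ≤ n) (hr : 3 ≤ r)
    (V : Type) [Fintype V] [DecidableEq V] (E : Finset (Finset V))
    (hunif : ∀ A ∈ E, A.card = n)
    (hchrom : ∀ c : V → Fin r, ∃ A ∈ E, ∃ i : Fin r, ∀ v ∈ A, c v = i) :
    (E.card : ℝ) ≥ (1 / 4) * (n : ℝ) ^ ((1 : ℝ) / 2) * (r : ℝ) ^ (n - 1) := by
  have hr0 : (0 : ℝ) < r := by positivity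
  have hrp : (0 : ℝ) < (r : ℝ) ^ (n - 1) := by positivity
  rcases lt_or_ge n 16 with h16 | h16
  · have h1 := trivial_bound n r hn hr V E hunif hchrom
    have h2 : (r : ℝ) ^ (n - 1) ≤ E.card := by exact_mod_cast h1
    have h3 : (n : ℝ) ^ ((1 : ℝ) / 2) ≤ 4 := by
      rw [← Real.sqrt_eq_rpow, Real.sqrt_le_left (by norm_num)]
      have : (n : ℝ) < 16 := by exact_mod_cast h16
      linarith
    nlinarith
  by_contra hcon
  push Not at hcon
  obtain ⟨R, rfl⟩ : ∃ R, r = R + 1 := ⟨r - 1, by omega⟩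
  let _ : LinearOrder V := LinearOrder.lift' (Fintype.equivFin V) (Fintype.equivFin V).injective
  set y : ℝ := Real.sqrt (Real.sqrt n) with hy
  have hy2 : y ^ 2 = Real.sqrt n := Real.sq_sqrt (Real.sqrt_nonneg _)
  have hy4 : (n : ℝ) = y ^ 4 := by
    have : y ^ 4 = (y ^ 2) ^ 2 := by ring
    rw [this, hy2, Real.sq_sqrt (Nat.cast_nonneg n)]
  have hy2' : 2 ≤ y := by
    have h1 : (16 : ℝ) ≤ n := by exact_mod_cast h16
    have h2 : (4 : ℝ) ≤ Real.sqrt n := Real.le_sqrt_of_sq_le (by linarith)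
    exact Real.le_sqrt_of_sq_le (by linarith)
  have hy0 : 0 < y := by linarith
  rw [← Real.sqrt_eq_rpow, ← hy2] at hcon
  clear_value y
  clear hy hy2
  have hlim := ineq_lim E n R hn hunif (8 / 3 / y ^ 3) (by positivity) hchrom
  push_cast at hcon hrp
  obtain ⟨k, hk⟩ : ∃ k : ℝ, k = E.card / ((R : ℝ) + 1) ^ (n - 1) := ⟨_, rfl⟩
  have hk0 : 0 ≤ k := by rw [hk]; exact div_nonneg (Nat.cast_nonneg _) hrp.le
  have hkE : (E.card : ℝ) = k * ((R : ℝ) + 1) ^ (n - 1) := by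
    rw [hk, div_mul_cancel₀ _ hrp.ne']
  have hk1 : k ≤ y ^ 2 / 4 := by
    rw [hk, div_le_iff₀ hrp]; linarith
  have t1 := term1 y hy2' n hy4
  have t2 := term2 y hy2' R (by omega)
  have a1 : (E.card : ℝ) * n * (1 / ((R + 1) * (1 + 8 / 3 / y ^ 3))) ^ (n - 1) ≤
      y ^ 6 / 4 * (1 / (1 + 8 / 3 / y ^ 3)) ^ (n - 1) := by
    have : (E.card : ℝ) * n * (1 / ((R + 1) * (1 + 8 / 3 / y ^ 3))) ^ (n - 1) =
        k * n * (1 / (1 + 8 / 3 / y ^ 3)) ^ (n - 1) := by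
      rw [hkE, div_pow, div_pow, mul_pow, one_pow]
      have hc : (0 : ℝ) < (1 + 8 / 3 / y ^ 3) ^ (n - 1) := by positivity
      generalize (1 + 8 / 3 / y ^ 3) ^ (n - 1) = c at *
      generalize ((R : ℝ) + 1) ^ (n - 1) = d at *
      field_simp
    rw [this]
    have h6 : k * n ≤ y ^ 6 / 4 := by
      rw [hy4]
      calc k * y ^ 4 ≤ y ^ 2 / 4 * y ^ 4 := by gcongr
        _ = _ := by ring
    gcongr
  have a2 : (E.card : ℝ) ^ (R + 1) * (1 / (R + 1)) ^ ((R + 1) * (n - 1)) *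
      ((R + 1) * (8 / 3 / y ^ 3)) ^ R / R.factorial ≤
      y ^ 2 / 4 * (2 * (R + 1) / (3 * y)) ^ R / R.factorial := by
    have : (E.card : ℝ) ^ (R + 1) * (1 / (R + 1)) ^ ((R + 1) * (n - 1)) = k ^ (R + 1) := by
      rw [hkE, mul_comm (R + 1) (n - 1), pow_mul, ← mul_pow, mul_assoc, ← mul_pow]
      congr 1
      rw [mul_one_div_cancel (by positivity), one_pow, mul_one]
    rw [this]
    have hmid : k ^ (R + 1) * (((R : ℝ) + 1) * (8 / 3 / y ^ 3)) ^ R ≤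
        y ^ 2 / 4 * (2 * (R + 1) / (3 * y)) ^ R := by
      have h7 : k ^ (R + 1) ≤ (y ^ 2 / 4) ^ (R + 1) := pow_le_pow_left₀ hk0 hk1 _
      have h8 : (y ^ 2 / 4) * (((R : ℝ) + 1) * (8 / 3 / y ^ 3)) = 2 * (R + 1) / (3 * y) := by
        field_simp
        norm_num
      calc k ^ (R + 1) * (((R : ℝ) + 1) * (8 / 3 / y ^ 3)) ^ R
          ≤ (y ^ 2 / 4) ^ (R + 1) * (((R : ℝ) + 1) * (8 / 3 / y ^ 3)) ^ R :=
            mul_le_mul_of_nonneg_right h7 (by positivity)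
        _ = _ := by
          rw [← h8, mul_pow (y ^ 2 / 4), pow_succ]
          ring
    exact div_le_div_of_nonneg_right hmid (by positivity)
  linarith
end

section
/- For all integers n ≥ 2 and r ≥ 2: every n-uniform hypergraph whose chromatic number is greater than r has at least (π^{1/r} · e^{−1/(12(n−1))}) · (1/(e·√(2π))) · (n−1)^{1/2 − 1/(2r)} · r^{n + 2/r} edges; that is, m(n,r) ≥ (π^{1/r} · e^{−1/(12(n−1))}) · (1/(e·√(2π))) · (n−1)^{1/2 − 1/(2r)} · r^{n + 2/r}. -/
section helpers
open Finset

def Link {V : Type} {m : ℕ} (σ : V ≃ Fin m) (X Y : Finset V) : Prop :=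
  ∃ u, u ∈ X ∧ u ∈ Y ∧ (∀ x ∈ X, σ x ≤ σ u) ∧ ∀ y ∈ Y, σ u ≤ σ y

def Reach {V : Type} {m : ℕ} (E : Finset (Finset V)) (σ : V ≃ Fin m) : ℕ → V → Prop
  | 0, _ => True
  | k + 1, v => ∃ A ∈ E, (v ∈ A ∧ ∀ x ∈ A, σ x ≤ σ v) ∧
      ∃ u ∈ A, (∀ x ∈ A, σ u ≤ σ x) ∧ Reach E σ k u

def Chain {V : Type} {m r : ℕ} (σ : V ≃ Fin m) (A : Fin r → Finset V) : Prop :=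
  ∀ i j : Fin r, i.val + 1 = j.val → Link σ (A i) (A j)

lemma reach_chain {V : Type} {m : ℕ} (E : Finset (Finset V)) (σ : V ≃ Fin m) (k : ℕ) :
    ∀ v, Reach E σ k v → ∃ A : ℕ → Finset V, (∀ i < k, A i ∈ E) ∧
      (∀ i, i + 1 < k → Link σ (A i) (A (i+1))) ∧
      (0 < k → v ∈ A (k-1) ∧ ∀ x ∈ A (k-1), σ x ≤ σ v) := by
  induction k with
  | zero => intro v _; exact ⟨fun _ => ∅, by simp, by simp, by simp⟩
  | succ k ih =>
    rintro v ⟨B, hB, hv, u, hu, hmin, hR⟩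
    obtain ⟨A, h1, h2, h3⟩ := ih u hR
    refine ⟨Function.update A k B, ?_, ?_, ?_⟩
    · intro i hi
      by_cases h : i = k
      · subst h; simpa using hB
      · rw [Function.update_of_ne h]; exact h1 i (by omega)
    · intro i hi
      have hik : i ≠ k := by omega
      rw [Function.update_of_ne hik]
      by_cases h : i + 1 = k
      · subst h
        rw [Function.update_self]
        have := h3 (by omega)
        exact ⟨u, this.1, hu, this.2, hmin⟩
      · rw [Function.update_of_ne h]; exact h2 i (by omega)
    · intro _
      simpa using hv

lemma exists_chain_s11 {V : Type} {m n r : ℕ} (hn : 2 ≤ n) (hr : 2 ≤ r) (E : Finset (Finset V))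
    (hunif : ∀ A ∈ E, A.card = n)
    (hchrom : ∀ c : V → Fin r, ∃ A ∈ E, ∃ i : Fin r, ∀ v ∈ A, c v = i) (σ : V ≃ Fin m) :
    ∃ A : Fin r → Finset V, (∀ i, A i ∈ E) ∧ Chain σ A := by
  classical
  by_cases hR : ∃ v, Reach E σ r v
  · obtain ⟨v, hv⟩ := hR
    obtain ⟨A, h1, h2, -⟩ := reach_chain E σ r v hv
    refine ⟨fun i => A i, fun i => h1 i i.2, fun i j hij => ?_⟩
    have := h2 i (by omega)
    rw [hij] at this
    exact this
  · push Not at hR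
    exfalso
    obtain ⟨A, hA, i, hi⟩ := hchrom
      (fun v => ⟨Nat.findGreatest (fun k => Reach E σ k v) (r-1), by
        have := Nat.findGreatest_le (P := fun k => Reach E σ k v) (r-1); omega⟩)
    have hne : A.Nonempty := by
      rw [← Finset.card_pos, hunif A hA]; omega
    obtain ⟨u, hu, humin⟩ := A.exists_min_image σ hne
    obtain ⟨w, hw, hwmax⟩ := A.exists_max_image σ hne
    have e := (hi u hu).trans (hi w hw).symm
    simp only [Fin.mk.injEq] at e
    set f := Nat.findGreatest (fun k => Reach E σ k u) (r-1) with hf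
    have hPu : Reach E σ f u :=
      Nat.findGreatest_spec (P := fun k => Reach E σ k u) (m := 0) (by omega) trivial
    have hfle : f ≤ r - 1 := Nat.findGreatest_le (P := fun k => Reach E σ k u) (r-1)
    have hPw : Reach E σ (f+1) w := ⟨A, hA, ⟨hw, hwmax⟩, u, hu, humin, hPu⟩
    by_cases h : f + 1 ≤ r - 1
    · have := Nat.le_findGreatest (P := fun k => Reach E σ k w) h hPw
      omega
    · have : f + 1 = r := by omega
      rw [this] at hPw
      exact hR w hPw

section struct
variable {V : Type} {m n r : ℕ} {σ : V ≃ Fin m} {A : Fin r → Finset V}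

lemma chain_le (hn : 2 ≤ n) (hA : ∀ i, (A i).card = n) (hc : Chain σ A) (d : ℕ) :
    ∀ i j : Fin r, i.val + d + 1 = j.val → ∀ x ∈ A i, ∀ y ∈ A j, σ x ≤ σ y := by
  induction d with
  | zero =>
    intro i j hij x hx y hy
    obtain ⟨u, _, _, h1, h2⟩ := hc i j hij
    exact (h1 x hx).trans (h2 y hy)
  | succ d ih =>
    intro i j hij x hx y hy
    obtain ⟨u, hu, _, h1, h2⟩ := hc ⟨j.val - 1, by omega⟩ j (by simp; omega)
    exact (ih i ⟨j.val - 1, by omega⟩ (by simp; omega) x hx u hu).trans (h2 y hy)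

lemma chain_le' (hn : 2 ≤ n) (hA : ∀ i, (A i).card = n) (hc : Chain σ A)
    {i j : Fin r} (hij : i < j) {x y : V} (hx : x ∈ A i) (hy : y ∈ A j) : σ x ≤ σ y :=
  chain_le hn hA hc (j.val - i.val - 1) i j (by have : i.val < j.val := hij; omega) x hx y hy

lemma chain_disj (hn : 2 ≤ n) (hA : ∀ i, (A i).card = n) (hc : Chain σ A)
    {i j : Fin r} {x : V} (hx : x ∈ A i) (hy : x ∈ A j) : j.val ≤ i.val + 1 := by
  by_contra h
  have hk : i.val + 1 < r := by omega
  have hone : 1 < (A ⟨i.val + 1, hk⟩).card := by rw [hA]; omega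
  obtain ⟨y, hy', z, hz', hyz⟩ := Finset.one_lt_card.1 hone
  have key : ∀ y ∈ A ⟨i.val + 1, hk⟩, y = x := by
    intro y hy'
    apply σ.injective
    apply le_antisymm
    · exact chain_le' hn hA hc (by rw [Fin.lt_def]; simp; omega) hy' hy
    · exact chain_le' hn hA hc (by rw [Fin.lt_def]; simp) hx hy'
  exact hyz ((key y hy').trans (key z hz').symm)

lemma chain_uniq (hn : 2 ≤ n) (hA : ∀ i, (A i).card = n) (hc : Chain σ A)
    {i j : Fin r} (hij : i < j) {x y : V} (hx : x ∈ A i) (hx' : x ∈ A j)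
    (hy : y ∈ A i) (hy' : y ∈ A j) : x = y :=
  σ.injective (le_antisymm (chain_le' hn hA hc hij hx hy') (chain_le' hn hA hc hij hy hx'))

end struct

lemma perm_path {r : ℕ} (hr : 2 ≤ r) (τ : Equiv.Perm (Fin r))
    (h : ∀ i j : Fin r, i.val + 1 = j.val → (τ i).val ≤ (τ j).val + 1 ∧ (τ j).val ≤ (τ i).val + 1) :
    τ = 1 ∨ τ = Fin.revPerm := by
  obtain ⟨s, rfl⟩ : ∃ s, r = s + 2 := ⟨r - 2, by omega⟩
  have inj : ∀ i j : Fin (s+2), (τ i).val = (τ j).val → i.val = j.val := by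
    intro i j hij
    exact congrArg _ (τ.injective (Fin.ext hij))
  have h01 := h ⟨0, by omega⟩ ⟨1, by omega⟩ rfl
  have i01 := inj ⟨0, by omega⟩ ⟨1, by omega⟩
  by_cases hd : (τ ⟨1, by omega⟩).val = (τ ⟨0, by omega⟩).val + 1
  · left
    have key : ∀ k (hk : k + 1 < s + 2), (τ ⟨k, by omega⟩).val = (τ ⟨0, by omega⟩).val + k ∧
       (τ ⟨k+1, hk⟩).val = (τ ⟨0, by omega⟩).val + k + 1 := by
      intro k
      induction k with
      | zero => intro hk; simpa using hd
      | succ k ih =>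
        intro hk
        have := ih (by omega)
        have h1 := h ⟨k+1, by omega⟩ ⟨k+1+1, hk⟩ rfl
        have i1 := inj ⟨k+1, by omega⟩ ⟨k+1+1, hk⟩
        have i2 := inj ⟨k, by omega⟩ ⟨k+1+1, hk⟩
        simp only at i1 i2
        omega
    have hl := (key s (by omega)).2
    have hlt := (τ ⟨s+1, by omega⟩).2
    have h0 : (τ ⟨0, by omega⟩).val = 0 := by omega
    ext i
    by_cases hi : i.val = s + 1
    · have : i = ⟨s+1, by omega⟩ := Fin.ext hi
      rw [this]; simp; omega
    · have := (key i.val (by omega)).1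
      simp only [Fin.eta] at this
      simp; omega
  · right
    have key : ∀ k (hk : k + 1 < s + 2), (τ ⟨k, by omega⟩).val + k = (τ ⟨0, by omega⟩).val ∧
       (τ ⟨k+1, hk⟩).val + k + 1 = (τ ⟨0, by omega⟩).val := by
      intro k
      induction k with
      | zero => 
        intro hk
        simp only at i01
        have : (τ ⟨0 + 1, hk⟩).val = (τ ⟨1, by omega⟩).val := rfl
        omega
      | succ k ih =>
        intro hk
        have := ih (by omega)
        have h1 := h ⟨k+1, by omega⟩ ⟨k+1+1, hk⟩ rfl
        have i1 := inj ⟨k+1, by omega⟩ ⟨k+1+1, hk⟩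
        have i2 := inj ⟨k, by omega⟩ ⟨k+1+1, hk⟩
        simp only at i1 i2
        omega
    have hl := (key s (by omega)).2
    have hlt := (τ ⟨0, by omega⟩).2
    have h0 : (τ ⟨0, by omega⟩).val = s + 1 := by omega
    ext i
    by_cases hi : i.val = s + 1
    · have : i = ⟨s+1, by omega⟩ := Fin.ext hi
      rw [this, Fin.revPerm_apply, Fin.val_rev]; simp only; omega
    · have := (key i.val (by omega)).1
      simp only [Fin.eta] at this
      simp [Fin.val_rev]; omega

lemma good_count {V : Type} [DecidableEq V] {m n r : ℕ} (hn : 2 ≤ n) (hr : 2 ≤ r)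
    (E : Finset (Finset V)) (hunif : ∀ A ∈ E, A.card = n)
    (G : Finset (Fin r → Finset V))
    (hG : ∀ A ∈ G, (∀ i, A i ∈ E) ∧ ∃ σ : V ≃ Fin m, Chain σ A) :
    G.card * r.factorial ≤ 2 * E.card ^ r := by
  classical
  have e1 : ∀ π : Equiv.Perm (Fin r),
      ((Fintype.piFinset fun _ : Fin r => E).filter (fun A => A ∘ π ∈ G)).card = G.card := by
    intro π
    apply Finset.card_bij (fun A _ => A ∘ π)
    · intro A hA; exact (Finset.mem_filter.1 hA).2
    · intro A _ B _ hAB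
      funext i
      have := congrFun hAB (π.symm i)
      simpa using this
    · intro B hB
      refine ⟨B ∘ π.symm, ?_, ?_⟩
      · rw [Finset.mem_filter, Fintype.mem_piFinset]
        refine ⟨fun i => (hG B hB).1 _, ?_⟩
        convert hB using 1
        funext i; simp
      · funext i; simp
  have e2 : ∀ A ∈ (Fintype.piFinset fun _ : Fin r => E),
      ((Finset.univ : Finset (Equiv.Perm (Fin r))).filter (fun π : Equiv.Perm (Fin r) => A ∘ ⇑π ∈ G)).card ≤ 2 := by
    intro A _
    by_cases hne : ∃ π : Equiv.Perm (Fin r), A ∘ π ∈ G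
    · obtain ⟨π₁, h₁⟩ := hne
      have : (Finset.univ : Finset (Equiv.Perm (Fin r))).filter (fun π : Equiv.Perm (Fin r) => A ∘ ⇑π ∈ G) ⊆
          {π₁, π₁ * Fin.revPerm} := by
        intro π hπ
        have h₂ := (Finset.mem_filter.1 hπ).2
        obtain ⟨hE1, σ₁, c₁⟩ := hG _ h₁
        obtain ⟨hE2, σ₂, c₂⟩ := hG _ h₂
        have := perm_path hr (π₁⁻¹ * π) (by
          intro i j hij
          obtain ⟨u, hu, hu', -⟩ := c₂ i j hij
          have hA1 : ∀ i, ((A ∘ π₁) i).card = n := fun i => hunif _ (hE1 i)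
          have a1 : u ∈ (A ∘ π₁) ((π₁⁻¹ * π) i) := by simpa using hu
          have a2 : u ∈ (A ∘ π₁) ((π₁⁻¹ * π) j) := by simpa using hu'
          exact ⟨chain_disj hn hA1 c₁ a2 a1, chain_disj hn hA1 c₁ a1 a2⟩)
        rw [Finset.mem_insert, Finset.mem_singleton]
        rcases this with h | h
        · left; rw [inv_mul_eq_one] at h; exact h.symm
        · right; rw [← h]; group
      exact (Finset.card_le_card this).trans Finset.card_le_two
    · push Not at hne
      rw [Finset.filter_false_of_mem (fun π _ => hne π)]; simp
  calc G.card * r.factorial = ∑ π : Equiv.Perm (Fin r), 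
        ((Fintype.piFinset fun _ : Fin r => E).filter (fun A => A ∘ π ∈ G)).card := by
        rw [Finset.sum_congr rfl (fun π _ => e1 π)]
        simp [Fintype.card_perm, mul_comm]
    _ = ∑ A ∈ (Fintype.piFinset fun _ : Fin r => E),
      ((Finset.univ : Finset (Equiv.Perm (Fin r))).filter (fun π : Equiv.Perm (Fin r) => A ∘ ⇑π ∈ G)).card := by
        simp only [Finset.card_filter]
        rw [Finset.sum_comm]
    _ ≤ ∑ A ∈ (Fintype.piFinset fun _ : Fin r => E), 2 := Finset.sum_le_sum e2
    _ = 2 * E.card ^ r := by simp [mul_comm]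

lemma unique_mono {S : Type} [Fintype S] [LinearOrder S] {k : ℕ} (c : S → Fin k)
    (π₁ π₂ : Equiv.Perm S) (h₁ : Monotone (c ∘ π₁)) (h₂ : Monotone (c ∘ π₂)) :
    c ∘ π₁ = c ∘ π₂ := by
  let e := Fintype.orderIsoFinOfCardEq S rfl
  have := Tuple.unique_monotone (f := c ∘ e)
    (σ := (e.toEquiv.trans π₁).trans e.symm.toEquiv) (τ := (e.toEquiv.trans π₂).trans e.symm.toEquiv)
    (by
      have := h₁.comp e.monotone
      intro a b hab
      simpa using this hab) (by
      have := h₂.comp e.monotone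
      intro a b hab
      simpa using this hab)
  funext x
  have := congrFun this (e.symm x)
  simpa using this

lemma compat_count {V : Type} [Fintype V] [DecidableEq V] {m k : ℕ} (hm : Fintype.card V = m)
    (S : Finset V) (c : S → Fin k) (X : Finset (V ≃ Fin m))
    (hX : ∀ σ ∈ X, ∀ x y : S, c x < c y → σ x < σ y) :
    X.card * S.card.factorial ≤
      m.factorial * ∏ i : Fin k, (Fintype.card {a // c a = i}).factorial := by
  classical
  have e1 : ∀ π : Equiv.Perm S,
      ((Finset.univ : Finset (V ≃ Fin m)).filter
        (fun σ => (Equiv.Perm.ofSubtype π).trans σ ∈ X)).card = X.card := by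
    intro π
    apply Finset.card_bij (fun σ _ => (Equiv.Perm.ofSubtype π).trans σ)
    · intro A hA; exact (Finset.mem_filter.1 hA).2
    · intro A _ B _ hAB
      ext i
      have := congrArg (fun f : V ≃ Fin m => f ((Equiv.Perm.ofSubtype π).symm i)) hAB
      simp only [Equiv.trans_apply, Equiv.apply_symm_apply] at this
      rw [this]
    · intro B hB
      refine ⟨(Equiv.Perm.ofSubtype π).symm.trans B, ?_, ?_⟩
      · rw [Finset.mem_filter]
        refine ⟨Finset.mem_univ _, ?_⟩
        convert hB using 1
        ext i; simp
      · ext i; simp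
  have e2 : ∀ σ : V ≃ Fin m,
      ((Finset.univ : Finset (Equiv.Perm S)).filter
        (fun π : Equiv.Perm S => (Equiv.Perm.ofSubtype π).trans σ ∈ X)).card ≤
          ∏ i : Fin k, (Fintype.card {a // c a = i}).factorial := by
    intro σ
    let _ : LinearOrder S := LinearOrder.lift' (fun x : S => σ x)
      (fun x y h => Subtype.ext (σ.injective h))
    have hmono : ∀ π : Equiv.Perm S, (Equiv.Perm.ofSubtype π).trans σ ∈ X →
        Monotone (c ∘ ⇑(π⁻¹)) := by
      intro π hπ a b hab
      by_contra hlt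
      rw [not_le] at hlt
      have := hX _ hπ _ _ hlt
      have h2 : σ a ≤ σ b := hab
      simp only [Equiv.trans_apply, Equiv.Perm.ofSubtype_apply_coe] at this
      rw [← Equiv.Perm.mul_apply, ← Equiv.Perm.mul_apply, mul_inv_cancel] at this
      exact absurd this (not_lt.2 h2)
    rw [← DomMulAct.stabilizer_card c]
    by_cases hne : ∃ π : Equiv.Perm S, (Equiv.Perm.ofSubtype π).trans σ ∈ X
    · obtain ⟨π₁, h₁⟩ := hne
      rw [← Fintype.card_coe]
      apply Fintype.card_le_of_injective
        (fun π => (⟨(π.1)⁻¹ * π₁, by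
          have h := unique_mono c _ _ (hmono π.1 (Finset.mem_filter.1 π.2).2) (hmono π₁ h₁)
          funext x
          have := congrFun h (π₁ x)
          simpa using this⟩ : {g : Equiv.Perm S // c ∘ g = c}))
      intro a b hab
      simp only [Subtype.mk.injEq, mul_left_inj, inv_inj] at hab
      exact Subtype.ext hab
    · push Not at hne
      rw [Finset.filter_false_of_mem (fun π _ => hne π)]; simp
  calc X.card * S.card.factorial = ∑ π : Equiv.Perm S, 
        ((Finset.univ : Finset (V ≃ Fin m)).filter
        (fun σ => (Equiv.Perm.ofSubtype π).trans σ ∈ X)).card := by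
        rw [Finset.sum_congr rfl (fun π _ => e1 π)]
        simp [Fintype.card_perm, mul_comm]
    _ = ∑ σ : V ≃ Fin m, ((Finset.univ : Finset (Equiv.Perm S)).filter
        (fun π : Equiv.Perm S => (Equiv.Perm.ofSubtype π).trans σ ∈ X)).card := by
        simp only [Finset.card_filter]
        rw [Finset.sum_comm]
    _ ≤ ∑ σ : V ≃ Fin m, ∏ i : Fin k, (Fintype.card {a // c a = i}).factorial :=
        Finset.sum_le_sum (fun σ _ => e2 σ)
    _ = _ := by
        rw [Finset.sum_const, smul_eq_mul, Finset.card_univ,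
          Fintype.card_equiv (Fintype.equivFinOfCardEq hm), hm]

open Real in
lemma factorial_upper (N : ℕ) (hN : 1 ≤ N) :
    (N.factorial : ℝ) ≤ √(2 * π * N) * (N / exp 1) ^ N * exp (1 / (12 * N)) := by
  have anti : Monotone (fun k : ℕ => log (Stirling.stirlingSeq (k+1)) - 1 / (12 * ((k:ℝ)+1))) := by
    apply monotone_nat_of_le_succ
    intro k
    have := Stirling.log_stirlingSeq_sdiff_le (k+1)
    have e : (1:ℝ) / (12 * (k+1) * (k+1+1)) = 1 / (12 * ((k:ℝ)+1)) - 1 / (12 * ((k:ℝ)+1+1)) := by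
      field_simp; ring
    push_cast at this ⊢
    linarith
  have lim : Filter.Tendsto (fun k : ℕ => log (Stirling.stirlingSeq (k+1)) - 1 / (12 * ((k:ℝ)+1)))
      Filter.atTop (nhds (log (√π) - 0)) := by
    apply Filter.Tendsto.sub
    · exact ((Filter.tendsto_add_atTop_iff_nat 1).2 Stirling.tendsto_stirlingSeq_sqrt_pi).log
        (by positivity)
    · have h := (tendsto_one_div_add_atTop_nhds_zero_nat (𝕜 := ℝ)).const_mul (1/12)
      simp only [mul_zero] at h
      refine h.congr (fun k => ?_)
      field_simp
  obtain ⟨k, rfl⟩ : ∃ k, N = k + 1 := ⟨N - 1, by omega⟩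
  have h := anti.ge_of_tendsto lim k
  have hpos := Stirling.stirlingSeq'_pos k
  have h2 : Stirling.stirlingSeq (k+1) ≤ √π * exp (1 / (12 * ((k:ℝ)+1))) := by
    rw [← Real.log_le_log_iff hpos (by positivity), Real.log_mul (by positivity) (by positivity),
      Real.log_exp]
    linarith
  rw [Stirling.stirlingSeq, div_le_iff₀ (by positivity)] at h2
  refine h2.trans (le_of_eq ?_)
  push_cast
  rw [show (2 * π * ((k:ℝ)+1)) = π * (2 * (k+1)) by ring, Real.sqrt_mul Real.pi_pos.le (2 * ((k:ℝ)+1))]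
  ring

section structB
variable {V : Type} [DecidableEq V] {m n r : ℕ} {σ : V ≃ Fin m} {A : Fin r → Finset V}

lemma exists_label (hn : 2 ≤ n) (hA : ∀ i, (A i).card = n) (hc : Chain σ A) :
    ∃ c : V → ℕ, (∀ x, (∃ i, x ∈ A i) → ∃ i j : Fin r, (j.val = i.val ∨ j.val = i.val + 1) ∧
        x ∈ A i ∧ x ∈ A j ∧ c x = i.val + j.val) ∧
      (∀ x, ∀ i j : Fin r, i.val + 1 = j.val → x ∈ A i → x ∈ A j → c x = i.val + j.val) := by
  classical
  have key : ∀ x, ∃ t : ℕ, ((∃ i, x ∈ A i) → ∃ i j : Fin r, (j.val = i.val ∨ j.val = i.val + 1) ∧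
        x ∈ A i ∧ x ∈ A j ∧ t = i.val + j.val) ∧
      (∀ i j : Fin r, i.val + 1 = j.val → x ∈ A i → x ∈ A j → t = i.val + j.val) := by
    intro x
    by_cases h : ∃ i j : Fin r, i.val + 1 = j.val ∧ x ∈ A i ∧ x ∈ A j
    · obtain ⟨i, j, hij, hi, hj⟩ := h
      refine ⟨i.val + j.val, fun _ => ⟨i, j, Or.inr hij.symm, hi, hj, rfl⟩, ?_⟩
      intro i' j' hij' hi' hj'
      have h1 := chain_disj hn hA hc hi hj'
      have h2 := chain_disj hn hA hc hi' hj
      omega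
    · push Not at h
      by_cases h2 : ∃ i, x ∈ A i
      · obtain ⟨i, hi⟩ := h2
        exact ⟨i.val + i.val, fun _ => ⟨i, i, Or.inl rfl, hi, hi, rfl⟩,
          fun i j hij hi hj => absurd hj (h i j hij hi)⟩
      · exact ⟨0, fun h => absurd h h2, fun i j hij hi hj => absurd hj (h i j hij hi)⟩
  choose c h1 h2 using key
  exact ⟨c, h1, h2⟩

lemma union_card (hn : 2 ≤ n) (hA : ∀ i, (A i).card = n) (hc : Chain σ A) (k : ℕ) (hk : k < r) :
    (n - 1) * (k + 1) + 1 ≤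
      ((Finset.univ.filter (fun i : Fin r => i.val ≤ k)).biUnion A).card := by
  induction k with
  | zero =>
    have : A ⟨0, hk⟩ ⊆ (Finset.univ.filter (fun i : Fin r => i.val ≤ 0)).biUnion A :=
      Finset.subset_biUnion_of_mem A (by simp)
    have := Finset.card_le_card this
    rw [hA] at this
    omega
  | succ k ih =>
    have ih := ih (by omega)
    obtain ⟨v, hv, hv', -⟩ := hc ⟨k, by omega⟩ ⟨k+1, hk⟩ rfl
    have hd : Disjoint ((Finset.univ.filter (fun i : Fin r => i.val ≤ k)).biUnion A)
        ((A ⟨k+1, hk⟩).erase v) := by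
      rw [Finset.disjoint_left]
      intro x hx hx'
      obtain ⟨i, hi, hxi⟩ := Finset.mem_biUnion.1 hx
      have hi := (Finset.mem_filter.1 hi).2
      obtain ⟨hne, hxk⟩ := Finset.mem_erase.1 hx'
      have h1 := chain_disj hn hA hc hxi hxk
      have : i = ⟨k, by omega⟩ := Fin.ext (by simp only at h1 ⊢; omega)
      rw [this] at hxi
      exact hne (chain_uniq hn hA hc (by rw [Fin.lt_def]; simp) hxi hxk hv hv')
    have hs : (Finset.univ.filter (fun i : Fin r => i.val ≤ k)).biUnion A ∪
        ((A ⟨k+1, hk⟩).erase v) ⊆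
        (Finset.univ.filter (fun i : Fin r => i.val ≤ k + 1)).biUnion A := by
      apply Finset.union_subset
      · apply Finset.biUnion_subset_biUnion_of_subset_left
        intro i hi
        simp only [Finset.mem_filter, Finset.mem_univ, true_and] at hi ⊢
        omega
      · exact (Finset.erase_subset _ _).trans (Finset.subset_biUnion_of_mem A (by simp))
    have := Finset.card_le_card hs
    rw [Finset.card_union_of_disjoint hd, Finset.card_erase_of_mem hv', hA] at this
    have e : (n - 1) * (k + 1 + 1) = (n-1) * (k+1) + (n-1) := by ring
    omega

lemma prod_pairs (g : ℕ → ℕ) (r : ℕ) :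
    ∏ t ∈ Finset.range (2 * r), g t = ∏ i ∈ Finset.range r, (g (2 * i) * g (2 * i + 1)) := by
  induction r with
  | zero => simp
  | succ r ih =>
    rw [show 2 * (r + 1) = 2 * r + 1 + 1 by ring, Finset.prod_range_succ, Finset.prod_range_succ,
      Finset.prod_range_succ, ih]
    ring

lemma chain_count [Fintype V] (hn : 2 ≤ n) (hr : 2 ≤ r) (hm : Fintype.card V = m)
    (hA : ∀ i, (A i).card = n) (hc : Chain σ A)
    (X : Finset (V ≃ Fin m)) (hX : ∀ σ ∈ X, Chain σ A) :
    X.card * ((n - 1) * r + 1).factorial ≤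
      m.factorial * ((n - 1).factorial ^ 2 * (n - 2).factorial ^ (r - 2)) := by
  classical
  obtain ⟨c, c1, c2⟩ := exists_label hn hA hc
  let S : Finset V := Finset.univ.biUnion A
  have hS : ∀ x ∈ S, ∃ i, x ∈ A i := by
    intro x hx
    obtain ⟨i, -, hi⟩ := Finset.mem_biUnion.1 hx
    exact ⟨i, hi⟩
  have hlt : ∀ x : S, c x < 2 * r := by
    intro x
    obtain ⟨i, j, _, _, _, h⟩ := c1 x (hS x x.2)
    omega
  have hScard : (n - 1) * r + 1 ≤ S.card := by
    have := union_card hn hA hc (r-1) (by omega)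
    rw [show r - 1 + 1 = r by omega] at this
    refine this.trans (Finset.card_le_card ?_)
    exact Finset.biUnion_subset_biUnion_of_subset_left _ (Finset.subset_univ _)
  have main := compat_count hm S (fun x => (⟨c x, hlt x⟩ : Fin (2 * r))) X (by
    intro σ hσ x y hxy
    have hc' := hX σ hσ
    rw [Fin.lt_def] at hxy
    simp only at hxy
    have hne : σ x ≠ σ y := by
      intro h
      rw [σ.injective h] at hxy
      omega
    refine lt_of_le_of_ne ?_ hne
    obtain ⟨i, j, hij, hi, hj, h⟩ := c1 x (hS x x.2)
    obtain ⟨k, l, hkl, hk, hl, h'⟩ := c1 y (hS y y.2)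
    by_cases hik : i.val < k.val
    · exact chain_le' hn hA hc' hik hi hk
    · exact chain_le' hn hA hc' (show j < l by rw [Fin.lt_def]; omega) hj hl)
  let F : ℕ → Finset V := fun t => S.filter (fun x => c x = t)
  have hF : ∀ t : Fin (2 * r), Fintype.card {a : S // (⟨c a, hlt a⟩ : Fin (2 * r)) = t} ≤
      (F t.val).card := by
    intro t
    rw [← Fintype.card_coe]
    apply Fintype.card_le_of_injective
      (fun a => (⟨a.1.1, by
        rw [Finset.mem_filter]
        exact ⟨a.1.2, congrArg Fin.val a.2⟩⟩ : F t.val))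
    intro a b hab
    simp only [Subtype.mk.injEq] at hab
    exact Subtype.ext (Subtype.ext hab)
  have hprod : ∏ t : Fin (2 * r), (Fintype.card
      {a : S // (⟨c a, hlt a⟩ : Fin (2 * r)) = t}).factorial ≤
      ∏ t ∈ Finset.range (2 * r), (F t).card.factorial := by
    rw [Finset.prod_range]
    exact Finset.prod_le_prod' (fun t _ => Nat.factorial_le (hF t))
  have hodd : ∀ i, (F (2 * i + 1)).card ≤ 1 := by
    intro i
    rw [Finset.card_le_one]
    intro x hx y hy
    obtain ⟨hx, hxc⟩ := Finset.mem_filter.1 hx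
    obtain ⟨hy, hyc⟩ := Finset.mem_filter.1 hy
    obtain ⟨a, b, hab, ha, hb, h⟩ := c1 x (hS x hx)
    obtain ⟨a', b', hab', ha', hb', h'⟩ := c1 y (hS y hy)
    have e1 : a' = a := Fin.ext (by omega)
    have e2 : b' = b := Fin.ext (by omega)
    subst e1 e2
    exact chain_uniq hn hA hc (show a' < b' by rw [Fin.lt_def]; omega) ha hb ha' hb'
  have heven : ∀ i (hi : i < r), ∀ x ∈ F (2 * i), x ∈ A ⟨i, hi⟩ := by
    intro i hi x hx
    obtain ⟨hx, hxc⟩ := Finset.mem_filter.1 hx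
    obtain ⟨a, b, hab, ha, hb, h⟩ := c1 x (hS x hx)
    have e1 : a = ⟨i, hi⟩ := Fin.ext (by simp only; omega)
    rw [← e1]; exact ha
  have hend : ∀ i (hi : i < r), (F (2 * i)).card ≤ n - 1 := by
    intro i hi
    have hp : ∃ v ∈ A ⟨i, hi⟩, c v ≠ 2 * i := by
      by_cases h0 : i + 1 < r
      · obtain ⟨v, hv, hv', -⟩ := hc ⟨i, hi⟩ ⟨i+1, h0⟩ rfl
        refine ⟨v, hv, ?_⟩
        rw [c2 v _ _ rfl hv hv']; simp only; omega
      · obtain ⟨v, hv, hv', -⟩ := hc ⟨i-1, by omega⟩ ⟨i, hi⟩ (by simp only; omega)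
        refine ⟨v, hv', ?_⟩
        rw [c2 v _ _ (by simp only; omega) hv hv']; simp only; omega
    obtain ⟨v, hv, hvc⟩ := hp
    rw [← hA ⟨i, hi⟩, ← Finset.card_erase_of_mem hv]
    apply Finset.card_le_card
    intro x hx
    rw [Finset.mem_erase]
    refine ⟨?_, heven i hi x hx⟩
    rintro rfl
    exact hvc (Finset.mem_filter.1 hx).2
  have hmid : ∀ i (hi : i + 1 < r), 0 < i → (F (2 * i)).card ≤ n - 2 := by
    intro i hi h0
    obtain ⟨v, hv, hv', -⟩ := hc ⟨i, by omega⟩ ⟨i+1, hi⟩ rfl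
    obtain ⟨w, hw, hw', -⟩ := hc ⟨i-1, by omega⟩ ⟨i, by omega⟩ (by simp only; omega)
    have cv := c2 v _ _ rfl hv hv'
    have cw := c2 w _ _ (by simp only; omega) hw hw'
    simp only at cv cw
    have hvw : v ≠ w := by
      rintro rfl
      omega
    have e : (((A ⟨i, by omega⟩).erase v).erase w).card = n - 2 := by
      rw [Finset.card_erase_of_mem (Finset.mem_erase.2 ⟨hvw.symm, hw'⟩),
        Finset.card_erase_of_mem hv, hA]
      omega
    rw [← e]
    apply Finset.card_le_card
    intro x hx
    have hxc := (Finset.mem_filter.1 hx).2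
    rw [Finset.mem_erase, Finset.mem_erase]
    refine ⟨?_, ?_, heven i (by omega) x hx⟩
    · rintro rfl; omega
    · rintro rfl; omega
  have hprod2 : ∏ t ∈ Finset.range (2 * r), (F t).card.factorial ≤
      (n - 1).factorial ^ 2 * (n - 2).factorial ^ (r - 2) := by
    rw [prod_pairs (fun t => (F t).card.factorial)]
    obtain ⟨s, rfl⟩ : ∃ s, r = s + 2 := ⟨r - 2, by omega⟩
    rw [Finset.prod_range_succ, Finset.prod_range_succ']
    have one : ∀ i, (F (2 * i + 1)).card.factorial ≤ 1 := by
      intro i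
      exact (Nat.factorial_le (hodd i)).trans (by simp)
    have a1 : (F (2 * 0)).card.factorial * (F (2 * 0 + 1)).card.factorial ≤
        (n-1).factorial * 1 :=
      Nat.mul_le_mul (Nat.factorial_le (hend 0 (by omega))) (one 0)
    have a2 : (F (2 * (s+1))).card.factorial * (F (2 * (s+1) + 1)).card.factorial ≤
        (n-1).factorial * 1 :=
      Nat.mul_le_mul (Nat.factorial_le (hend (s+1) (by omega))) (one (s+1))
    have a3 : ∏ k ∈ Finset.range s, ((F (2 * (k+1))).card.factorial *
        (F (2 * (k+1) + 1)).card.factorial) ≤ (n-2).factorial ^ s := by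
      calc _ ≤ ∏ k ∈ Finset.range s, (n-2).factorial := by
            apply Finset.prod_le_prod'
            intro k hk
            have hk := Finset.mem_range.1 hk
            have := Nat.mul_le_mul (Nat.factorial_le (hmid (k+1) (by omega) (by omega)))
              (one (k+1))
            simpa using this
        _ = _ := by simp
    refine (Nat.mul_le_mul (Nat.mul_le_mul a3 a1) a2).trans (le_of_eq ?_)
    simp only [Nat.add_sub_cancel]
    ring
  calc X.card * ((n - 1) * r + 1).factorial ≤ X.card * S.card.factorial :=
        Nat.mul_le_mul_left _ (Nat.factorial_le hScard)
    _ ≤ _ := main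
    _ ≤ _ := Nat.mul_le_mul_left _ (hprod.trans hprod2)

end structB

lemma nat_bound (n r : ℕ) (hn : 2 ≤ n) (hr : 2 ≤ r)
    (V : Type) [Fintype V] [DecidableEq V] (E : Finset (Finset V))
    (hunif : ∀ A ∈ E, A.card = n)
    (hchrom : ∀ c : V → Fin r, ∃ A ∈ E, ∃ i : Fin r, ∀ v ∈ A, c v = i) :
    ((n - 1) * r + 1).factorial * r.factorial ≤
      2 * E.card ^ r * ((n - 1).factorial ^ 2 * (n - 2).factorial ^ (r - 2)) := by
  classical
  obtain ⟨m, hm⟩ : ∃ m, Fintype.card V = m := ⟨_, rfl⟩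
  let G : Finset (Fin r → Finset V) := (Fintype.piFinset fun _ : Fin r => E).filter
    (fun A => ∃ σ : V ≃ Fin m, Chain σ A)
  have hG : ∀ A ∈ G, (∀ i, A i ∈ E) ∧ ∃ σ : V ≃ Fin m, Chain σ A := by
    intro A hA
    obtain ⟨h1, h2⟩ := Finset.mem_filter.1 hA
    exact ⟨Fintype.mem_piFinset.1 h1, h2⟩
  have hgc := good_count hn hr E hunif G hG
  let X : (Fin r → Finset V) → Finset (V ≃ Fin m) :=
    fun A => Finset.univ.filter (fun σ => Chain σ A)
  have hcover : m.factorial ≤ ∑ A ∈ G, (X A).card := by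
    have : (Finset.univ : Finset (V ≃ Fin m)) ⊆ G.biUnion X := by
      intro σ _
      obtain ⟨A, hA, hch⟩ := exists_chain_s11 hn hr E hunif hchrom σ
      rw [Finset.mem_biUnion]
      exact ⟨A, Finset.mem_filter.2 ⟨Fintype.mem_piFinset.2 hA, σ, hch⟩,
        Finset.mem_filter.2 ⟨Finset.mem_univ _, hch⟩⟩
    have h := (Finset.card_le_card this).trans Finset.card_biUnion_le
    rwa [Finset.card_univ, Fintype.card_equiv (Fintype.equivFinOfCardEq hm), hm] at h
  set Q := (n - 1).factorial ^ 2 * (n - 2).factorial ^ (r - 2) with hQ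
  have h1 : m.factorial * ((n - 1) * r + 1).factorial ≤ G.card * (m.factorial * Q) := by
    calc _ ≤ (∑ A ∈ G, (X A).card) * ((n - 1) * r + 1).factorial :=
          Nat.mul_le_mul_right _ hcover
      _ = ∑ A ∈ G, (X A).card * ((n - 1) * r + 1).factorial := Finset.sum_mul _ _ _
      _ ≤ ∑ A ∈ G, m.factorial * Q := by
          apply Finset.sum_le_sum
          intro A hA
          obtain ⟨hE, σ, hσ⟩ := hG A hA
          exact chain_count hn hr hm (fun i => hunif _ (hE i)) hσ (X A)
            (fun σ hσ => (Finset.mem_filter.1 hσ).2)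
      _ = _ := by simp
  have h2 : ((n - 1) * r + 1).factorial ≤ G.card * Q := by
    apply Nat.le_of_mul_le_mul_left _ (Nat.factorial_pos m)
    calc _ ≤ _ := h1
      _ = _ := by ring
  calc _ ≤ G.card * Q * r.factorial := Nat.mul_le_mul_right _ h2
    _ = G.card * r.factorial * Q := by ring
    _ ≤ _ := Nat.mul_le_mul_right _ hgc

open Real in
lemma real_bound (N r e : ℕ) (hN : 1 ≤ N) (hr : 2 ≤ r)
    (h : (N * r + 1).factorial * r.factorial ≤
      2 * e ^ r * (N.factorial ^ 2 * (N - 1).factorial ^ (r - 2))) :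
    (π ^ ((1 : ℝ) / r) * exp (-1 / (12 * (N : ℝ)))) *
        (1 / (exp 1 * √(2 * π))) *
        (N : ℝ) ^ ((1 : ℝ) / 2 - 1 / (2 * r)) *
        (r : ℝ) ^ ((N : ℝ) + 1 + 2 / r) ≤ (e : ℝ) := by
  have hNpos : (0:ℝ) < N := by exact_mod_cast hN
  have hrpos : (0:ℝ) < r := by exact_mod_cast (by omega : 0 < r)
  have hr0 : r ≠ 0 := by omega
  set D : ℝ := √(2 * π * N) * (N / exp 1) ^ N * exp (1 / (12 * N)) with hD
  set T : ℝ := (π ^ ((1 : ℝ) / r) * exp (-1 / (12 * (N : ℝ)))) *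
        (1 / (exp 1 * √(2 * π))) *
        (N : ℝ) ^ ((1 : ℝ) / 2 - 1 / (2 * r)) *
        (r : ℝ) ^ ((N : ℝ) + 1 + 2 / r) with hT
  have hDpos : 0 < D := by positivity
  have hTpos : 0 < T := by positivity
  have hs : √(N:ℝ) * √(N:ℝ) = N := Real.mul_self_sqrt hNpos.le
  -- natural number inequality, cleaned
  have h1 : (N * r * (N * r).factorial) * r.factorial * N ^ (r - 2) ≤
      2 * e ^ r * N.factorial ^ r := by
    have e1 : N.factorial = N * (N-1).factorial := (Nat.mul_factorial_pred (by omega)).symm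
    have e2 : N.factorial ^ r = N.factorial ^ 2 * (N ^ (r-2) * (N-1).factorial ^ (r-2)) := by
      rw [← mul_pow, ← e1, ← pow_add]; congr 1; omega
    calc _ ≤ (N * r + 1).factorial * r.factorial * N ^ (r-2) := by
          rw [Nat.factorial_succ]
          gcongr
          omega
      _ ≤ 2 * e ^ r * (N.factorial ^ 2 * (N - 1).factorial ^ (r - 2)) * N ^ (r-2) :=
          Nat.mul_le_mul_right _ h
      _ = _ := by rw [e2]; ring
  have h2 : ((N:ℝ) * r * (N * r).factorial) * r.factorial * (N:ℝ) ^ (r - 2) ≤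
      2 * (e:ℝ) ^ r * (N.factorial:ℝ) ^ r := by exact_mod_cast h1
  have s1 := Stirling.le_factorial_stirling (N * r)
  have s2 := Stirling.le_factorial_stirling r
  have s3 := factorial_upper N hN
  have h3 : ((N:ℝ) * r * (√(2 * π * (N * r : ℕ)) * ((N * r : ℕ) / exp 1) ^ (N * r))) *
      (√(2 * π * r) * (r / exp 1) ^ r) * (N:ℝ) ^ (r - 2) ≤ 2 * (e:ℝ) ^ r * D ^ r := by
    refine le_trans ?_ (h2.trans ?_)
    · gcongr
    · gcongr
  have hsq : √(2 * π * (N * r : ℕ)) * √(2 * π * r) = 2 * π * r * √N := by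
    rw [← Real.sqrt_mul (by positivity)]
    rw [show 2 * π * ((N * r : ℕ):ℝ) * (2 * π * r) = (2 * π * r) ^ 2 * N by push_cast; ring]
    rw [Real.sqrt_mul (by positivity), Real.sqrt_sq (by positivity)]
  have hTD : T * D = π ^ ((1 : ℝ) / r) * (exp 1)⁻¹ * (N : ℝ) ^ ((1 : ℝ) / 2 - 1 / (2 * r)) *
        (r : ℝ) ^ ((N : ℝ) + 1 + 2 / r) * √N * (N / exp 1) ^ N := by
    have hexp : exp (-1 / (12 * (N : ℝ))) * exp (1 / (12 * N)) = 1 := by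
      rw [← Real.exp_add]; simp [neg_div]
    have hq : √(2 * π * N) = √(2 * π) * √N := Real.sqrt_mul (by positivity) _
    have hq0 : √(2 * π) ≠ 0 := by positivity
    calc T * D = (exp (-1 / (12 * (N : ℝ))) * exp (1 / (12 * N))) * (√(2 * π) * (√(2 * π))⁻¹) *
          (π ^ ((1 : ℝ) / r) * (exp 1)⁻¹ * (N : ℝ) ^ ((1 : ℝ) / 2 - 1 / (2 * r)) *
        (r : ℝ) ^ ((N : ℝ) + 1 + 2 / r) * √N * (N / exp 1) ^ N) := by
          rw [hT, hD, hq, one_div (exp 1 * _), mul_inv]; ring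
      _ = _ := by rw [hexp, mul_inv_cancel₀ hq0]; ring
  have p1 : (π ^ ((1 : ℝ) / r)) ^ r = π := by
    rw [one_div]; exact Real.rpow_inv_natCast_pow pi_pos.le hr0
  have p2 : ((N : ℝ) ^ ((1 : ℝ) / 2 - 1 / (2 * r))) ^ r = √N ^ (r - 1) := by
    rw [← Real.rpow_mul_natCast hNpos.le, Real.sqrt_eq_rpow, ← Real.rpow_mul_natCast hNpos.le,
      Nat.cast_sub (by omega)]
    congr 1
    field_simp
    push_cast
    ring
  have p3 : ((r : ℝ) ^ ((N : ℝ) + 1 + 2 / r)) ^ r = (r:ℝ) ^ (N * r + r + 2) := by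
    rw [← Real.rpow_mul_natCast hrpos.le, ← Real.rpow_natCast]
    congr 1
    field_simp
    push_cast
    ring
  have hTDr : T ^ r * (2 * D ^ r) =
      ((N:ℝ) * r * (√(2 * π * (N * r : ℕ)) * ((N * r : ℕ) / exp 1) ^ (N * r))) *
      (√(2 * π * r) * (r / exp 1) ^ r) * (N:ℝ) ^ (r - 2) := by
    have : T ^ r * (2 * D ^ r) = 2 * (T * D) ^ r := by rw [mul_pow]; ring
    rw [this, hTD]
    simp only [mul_pow]
    rw [p1, p2, p3]
    obtain ⟨s, rfl⟩ : ∃ s, r = s + 2 := ⟨r - 2, by omega⟩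
    have q1 : √(N:ℝ) ^ (s + 2 - 1) * √(N:ℝ) ^ (s + 2) = N ^ (s+1) * √N := by
      rw [show s + 2 - 1 = s + 1 by omega, pow_succ _ (s+1), ← mul_assoc, ← mul_pow, hs]
    have q2 : (((N * (s+2) : ℕ):ℝ) / exp 1) ^ (N * (s+2)) =
       ((N / exp 1 : ℝ) ^ N) ^ (s+2) * ((s+2:ℕ):ℝ) ^ (N * (s+2)) := by
      rw [← pow_mul, ← mul_pow]; congr 1; push_cast; ring
    rw [q2]
    generalize ((N / exp 1 : ℝ) ^ N) ^ (s+2) = Z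
    rw [div_pow (((s+2:ℕ):ℝ)) (exp 1) (s+2)]
    calc _ = 2 * π * ((exp 1)⁻¹ ^ (s+2)) * (√(N:ℝ) ^ (s + 2 - 1) * √(N:ℝ) ^ (s + 2)) *
          ((s+2:ℕ):ℝ) ^ (N * (s+2) + (s+2) + 2) * Z := by ring
      _ = (2 * π * (s+2:ℕ) * √N) * N * (s+2:ℕ) * Z * ((s+2:ℕ):ℝ) ^ (N * (s+2)) *
          (((s+2:ℕ):ℝ) ^ (s+2) / exp 1 ^ (s+2)) * (N:ℝ) ^ (s + 2 - 2) := by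
          rw [q1, show s + 2 - 2 = s by omega, inv_pow]
          generalize ((s+2:ℕ):ℝ) = R
          ring
      _ = _ := by rw [← hsq]; ring
  have hfin : T ^ r ≤ (e:ℝ) ^ r := by
    have : T ^ r * (2 * D ^ r) ≤ (e:ℝ) ^ r * (2 * D ^ r) := by
      rw [hTDr]; refine h3.trans (le_of_eq (by ring))
    exact le_of_mul_le_mul_right this (by positivity)
  exact le_of_pow_le_pow_left₀ hr0 (by positivity) hfin

end helpers

/-- Shabanov's bound: for all `n ≥ 2` and `r ≥ 2`, every `n`-uniform hypergraph with
chromatic number greater than `r` has at least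
`(π^{1/r} · e^{−1/(12(n−1))}) · (1/(e√(2π))) · (n−1)^{1/2 − 1/(2r)} · r^{n + 2/r}` edges. -/
theorem stmt_11 (n r : ℕ) (hn : 2 ≤ n) (hr : 2 ≤ r)
    (V : Type) [Fintype V] [DecidableEq V] (E : Finset (Finset V))
    (hunif : ∀ A ∈ E, A.card = n)
    (hchrom : ∀ c : V → Fin r, ∃ A ∈ E, ∃ i : Fin r, ∀ v ∈ A, c v = i) :
    (E.card : ℝ) ≥
      (Real.pi ^ ((1 : ℝ) / r) * Real.exp (-1 / (12 * ((n : ℝ) - 1)))) *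
        (1 / (Real.exp 1 * Real.sqrt (2 * Real.pi))) *
        ((n : ℝ) - 1) ^ ((1 : ℝ) / 2 - 1 / (2 * r)) *
        (r : ℝ) ^ ((n : ℝ) + 2 / r) := by
  have h := real_bound (n - 1) r E.card (by omega) hr (nat_bound n r hn hr V E hunif hchrom)
  rw [Nat.cast_sub (by omega : 1 ≤ n)] at h
  push_cast at h
  rw [sub_add_cancel] at h
  exact h
end
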